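/- arXiv:2308.04414 — 5 statements merged into one kernel-verified Lean document; each statement's English description precedes it below -/
import Mathlib

section
/- Raviolo Hartogs extension (Proposition 1.4): Let U ⊆ ℂ × ℝ be open and K ⊆ U compact such that U ∖ K is connected. Then every smooth d′-closed function f : U ∖ K → ℂ is the restriction to U ∖ K of a smooth d′-closed function F : U → ℂ. -/
open Set

/-- A function on a subset of `ℂ × ℝ` is `d′`-closed on it if at every point of the set
the map `z ↦ f (z, t)` is complex differentiable at `z` and the map `t ↦ f (z, t)` has
vanishing derivative at `t`. -/
def DPrimeClosedOn (f : ℂ × ℝ → ℂ) (W : Set (ℂ × ℝ)) : Prop :=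
  ∀ p ∈ W, (∃ c : ℂ, HasDerivAt (fun w : ℂ => f (w, p.2)) c p.1) ∧
    HasDerivAt (fun s : ℝ => f (p.1, s)) 0 p.2

open MeasureTheory Filter Topology Convolution

/-- Twice the `∂/∂z̄` operator. -/
noncomputable def ravDbar (h : ℂ × ℝ → ℂ) (p : ℂ × ℝ) : ℂ :=
  fderiv ℝ h p (1, 0) + Complex.I * fderiv ℝ h p (Complex.I, 0)

/-- The `∂/∂t` operator. -/
noncomputable def ravDt (h : ℂ × ℝ → ℂ) (p : ℂ × ℝ) : ℂ := fderiv ℝ h p (0, 1)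

lemma rav_contDiffAt_fderiv {h : ℂ × ℝ → ℂ} {p : ℂ × ℝ} (hh : ContDiffAt ℝ (⊤ : ℕ∞) h p) :
    ContDiffAt ℝ (⊤ : ℕ∞) (fderiv ℝ h) p :=
  hh.fderiv_right (by simp)

lemma rav_contDiffAt_ravDt {h : ℂ × ℝ → ℂ} {p : ℂ × ℝ} (hh : ContDiffAt ℝ (⊤ : ℕ∞) h p) :
    ContDiffAt ℝ (⊤ : ℕ∞) (ravDt h) p :=
  (rav_contDiffAt_fderiv hh).clm_apply contDiffAt_const

lemma rav_contDiffAt_ravDbar {h : ℂ × ℝ → ℂ} {p : ℂ × ℝ} (hh : ContDiffAt ℝ (⊤ : ℕ∞) h p) :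
    ContDiffAt ℝ (⊤ : ℕ∞) (ravDbar h) p :=
  ((rav_contDiffAt_fderiv hh).clm_apply contDiffAt_const).add
    (contDiffAt_const.mul ((rav_contDiffAt_fderiv hh).clm_apply contDiffAt_const))

lemma rav_fderiv_fderiv {h : ℂ × ℝ → ℂ} {p : ℂ × ℝ} (hh : ContDiffAt ℝ (⊤ : ℕ∞) h p)
    (v : ℂ × ℝ) : HasFDerivAt (fun q => fderiv ℝ h q v)
      ((fderiv ℝ (fderiv ℝ h) p).flip v) p := by
  have h1 : DifferentiableAt ℝ (fderiv ℝ h) p :=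
    (rav_contDiffAt_fderiv hh).differentiableAt (by simp)
  have := h1.hasFDerivAt.clm_apply (hasFDerivAt_const v p)
  simpa using this

lemma rav_comm {h : ℂ × ℝ → ℂ} {p : ℂ × ℝ} (hh : ContDiffAt ℝ (⊤ : ℕ∞) h p) :
    ravDt (ravDbar h) p = ravDbar (ravDt h) p := by
  have hs : IsSymmSndFDerivAt ℝ h p := hh.isSymmSndFDerivAt (by
    rw [minSmoothness_of_isRCLikeNormedField]
    exact WithTop.coe_le_coe.2 (le_top : (2 : ℕ∞) ≤ ⊤))
  have h1 : fderiv ℝ (ravDbar h) p = _ := ((rav_fderiv_fderiv hh (1, 0)).add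
    ((rav_fderiv_fderiv hh (Complex.I, 0)).const_mul Complex.I)).fderiv
  have h2 : fderiv ℝ (ravDt h) p = _ := (rav_fderiv_fderiv hh (0, 1)).fderiv
  unfold ravDt ravDbar at *
  rw [h1, h2]
  simp [hs.eq (0, 1) (1, 0), hs.eq (0, 1) (Complex.I, 0)]

lemma rav_congr {h k : ℂ × ℝ → ℂ} {p : ℂ × ℝ} (e : h =ᶠ[𝓝 p] k) :
    ravDt h p = ravDt k p ∧ ravDbar h p = ravDbar k p := by
  unfold ravDt ravDbar
  rw [e.fderiv_eq]; simp

lemma rav_zero (p : ℂ × ℝ) : ravDt (fun _ => 0) p = 0 ∧ ravDbar (fun _ => 0) p = 0 := by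
  simp [ravDt, ravDbar]

lemma rav_sub {h k : ℂ × ℝ → ℂ} {p : ℂ × ℝ} (hh : DifferentiableAt ℝ h p)
    (hk : DifferentiableAt ℝ k p) :
    ravDt (fun q => h q - k q) p = ravDt h p - ravDt k p ∧
    ravDbar (fun q => h q - k q) p = ravDbar h p - ravDbar k p := by
  unfold ravDt ravDbar
  rw [fderiv_fun_sub hh hk]; simp; ring

lemma rav_slice_t {h : ℂ × ℝ → ℂ} {p : ℂ × ℝ} (hh : DifferentiableAt ℝ h p) :
    HasDerivAt (fun s : ℝ => h (p.1, s)) (ravDt h p) p.2 := by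
  have h1 : HasDerivAt (fun s : ℝ => ((p.1, s) : ℂ × ℝ)) (0, 1) p.2 :=
    (hasDerivAt_const _ _).prodMk (hasDerivAt_id _)
  exact HasFDerivAt.comp_hasDerivAt (f := fun s : ℝ => ((p.1, s) : ℂ × ℝ)) p.2
    (l := h) (l' := fderiv ℝ h p) hh.hasFDerivAt h1

lemma rav_slice_z {h : ℂ × ℝ → ℂ} {p : ℂ × ℝ} (hh : DifferentiableAt ℝ h p) :
    HasFDerivAt (fun w : ℂ => h (w, p.2))
      ((fderiv ℝ h p).comp (ContinuousLinearMap.inl ℝ ℂ ℝ)) p.1 := by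
  have h1 : HasFDerivAt (fun w : ℂ => ((w, p.2) : ℂ × ℝ)) (ContinuousLinearMap.inl ℝ ℂ ℝ) p.1 :=
    hasFDerivAt_prodMk_left p.1 p.2
  exact HasFDerivAt.comp (f := fun w : ℂ => ((w, p.2) : ℂ × ℝ)) p.1
    (g := h) (g' := fderiv ℝ h p) hh.hasFDerivAt h1

lemma rav_closed_iff {h : ℂ × ℝ → ℂ} {p : ℂ × ℝ} (hh : DifferentiableAt ℝ h p) :
    ((∃ c : ℂ, HasDerivAt (fun w : ℂ => h (w, p.2)) c p.1) ∧
      HasDerivAt (fun s : ℝ => h (p.1, s)) 0 p.2) ↔ ravDbar h p = 0 ∧ ravDt h p = 0 := by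
  have ht := rav_slice_t hh
  have hz := rav_slice_z hh
  have e1 : (∃ c : ℂ, HasDerivAt (fun w : ℂ => h (w, p.2)) c p.1) ↔ ravDbar h p = 0 := by
    have : (∃ c : ℂ, HasDerivAt (fun w : ℂ => h (w, p.2)) c p.1) ↔
        DifferentiableAt ℂ (fun w : ℂ => h (w, p.2)) p.1 :=
      ⟨fun ⟨c, hc⟩ => hc.differentiableAt, fun H => ⟨_, H.hasDerivAt⟩⟩
    rw [this, differentiableAt_complex_iff_differentiableAt_real, hz.fderiv]
    simp only [hz.differentiableAt, true_and, ravDbar]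
    simp only [ContinuousLinearMap.comp_apply, ContinuousLinearMap.inl_apply, smul_eq_mul]
    have hI := Complex.I_mul_I
    constructor
    · intro H
      rw [H]; linear_combination (fderiv ℝ h p (1, 0)) * hI
    · intro H
      linear_combination (-Complex.I) * H + (fderiv ℝ h p (Complex.I, 0)) * hI
  rw [e1]
  refine and_congr_right fun _ => ⟨fun H => ht.unique H, fun H => H ▸ ht⟩

lemma rav_primitive (S : Set (ℂ × ℝ)) (hS : IsCompact S) (T : ℝ) (hT : ∀ p ∈ S, T ≤ p.2)
    (b : ℂ × ℝ → ℂ) (hb : ContDiff ℝ (⊤ : ℕ∞) b) (hb0 : ∀ p ∉ S, b p = 0) :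
    ∃ u : ℂ × ℝ → ℂ, ContDiff ℝ (⊤ : ℕ∞) u ∧ (∀ p, ravDt u p = b p) ∧
      ∀ p : ℂ × ℝ, p.2 < T → u p = 0 := by
  set H : ℝ → ℝ := (Ici (0 : ℝ)).indicator (fun _ => 1) with hH
  set u : ℂ × ℝ → ℂ := fun q =>
    (H ⋆[ContinuousLinearMap.lsmul ℝ ℝ, volume] (fun s => b (q.1, s))) q.2 with hu
  have hk : IsCompact (Prod.snd '' S) := hS.image continuous_snd
  have hbk : ∀ z s, s ∉ Prod.snd '' S → b (z, s) = 0 := fun z s hs =>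
    hb0 _ fun hm => hs ⟨_, hm, rfl⟩
  have huc : ContDiff ℝ (⊤ : ℕ∞) u := by
    have := contDiffOn_convolution_right_with_param (𝕜 := ℝ) (μ := volume) (f := H) (n := (⊤ : ℕ∞))
      (ContinuousLinearMap.lsmul ℝ ℝ) (g := fun (z : ℂ) (s : ℝ) => b (z, s)) (s := univ)
      isOpen_univ hk (fun z s _ hs => hbk z s hs)
      ((locallyIntegrable_const (1 : ℝ)).indicator measurableSet_Ici)
      (by exact hb.contDiffOn)
    rw [univ_prod_univ] at this
    exact contDiffOn_univ.1 this
  have hue : ∀ z t, u (z, t) = ∫ s in Iic t, b (z, s) := by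
    intro z t
    simp only [hu]
    rw [convolution_eq_swap, ← integral_indicator measurableSet_Iic]
    congr 1
    ext s
    by_cases hs : s ≤ t <;> simp [hH, indicator, hs]
  have hbc : ∀ z, Continuous fun s => b (z, s) := fun z => hb.continuous.comp (by fun_prop)
  have hbi : ∀ z, Integrable fun s => b (z, s) := fun z =>
    (hbc z).integrable_of_hasCompactSupport (HasCompactSupport.intro hk (hbk z))
  refine ⟨u, huc, ?_, ?_⟩
  · rintro ⟨z, t⟩
    have h1 := rav_slice_t (huc.differentiable (by simp) (z, t))
    refine h1.unique ?_
    have h2 : (fun s : ℝ => u (z, s)) = fun s => (∫ r in (0 : ℝ)..s, b (z, r)) + u (z, 0) := by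
      ext s
      rw [hue, hue, ← intervalIntegral.integral_Iic_sub_Iic (hbi z).integrableOn
        (hbi z).integrableOn]
      ring
    simp only [h2]
    exact (((hbc z).integral_hasStrictDerivAt 0 t).hasDerivAt).add_const _
  · rintro ⟨z, t⟩ ht
    rw [hue]
    refine setIntegral_eq_zero_of_forall_eq_zero fun s hs => hb0 _ fun hm => ?_
    have := hT _ hm
    simp only [mem_Iic] at hs ht this
    linarith

lemma rav_core (U S : Set (ℂ × ℝ)) (hU : IsOpen U) (hS : IsCompact S) (hSU : S ⊆ U)
    (T : ℝ) (hT : ∀ p ∈ S, T ≤ p.2) (g : ℂ × ℝ → ℂ)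
    (hg : ∀ p ∈ U, ContDiffAt ℝ (⊤ : ℕ∞) g p)
    (hg0 : ∀ p ∈ U \ S, ravDbar g p = 0 ∧ ravDt g p = 0) :
    ∃ u : ℂ × ℝ → ℂ, ContDiff ℝ (⊤ : ℕ∞) u ∧ (∀ p : ℂ × ℝ, p.2 < T → u p = 0) ∧
      ∀ p ∈ U, ravDbar u p = ravDbar g p ∧ ravDt u p = ravDt g p := by
  classical
  have hSo : IsOpen Sᶜ := hS.isClosed.isOpen_compl
  set a : ℂ × ℝ → ℂ := U.indicator (ravDbar g) with ha
  set b : ℂ × ℝ → ℂ := U.indicator (ravDt g) with hb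
  have haU : ∀ p ∈ U, a =ᶠ[𝓝 p] ravDbar g := fun p hp => by
    filter_upwards [hU.mem_nhds hp] with q hq using indicator_of_mem hq _
  have hbU : ∀ p ∈ U, b =ᶠ[𝓝 p] ravDt g := fun p hp => by
    filter_upwards [hU.mem_nhds hp] with q hq using indicator_of_mem hq _
  have haS : ∀ p ∉ S, a p = 0 := fun p hp => by
    by_cases h : p ∈ U
    · rw [ha, indicator_of_mem h, (hg0 p ⟨h, hp⟩).1]
    · rw [ha, indicator_of_notMem h]
  have hbS : ∀ p ∉ S, b p = 0 := fun p hp => by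
    by_cases h : p ∈ U
    · rw [hb, indicator_of_mem h, (hg0 p ⟨h, hp⟩).2]
    · rw [hb, indicator_of_notMem h]
  have haS' : ∀ p ∉ S, a =ᶠ[𝓝 p] fun _ => 0 := fun p hp => by
    filter_upwards [hSo.mem_nhds hp] with q hq using haS q hq
  have hbS' : ∀ p ∉ S, b =ᶠ[𝓝 p] fun _ => 0 := fun p hp => by
    filter_upwards [hSo.mem_nhds hp] with q hq using hbS q hq
  have hac : ContDiff ℝ (⊤ : ℕ∞) a := contDiff_iff_contDiffAt.2 fun p => by
    by_cases h : p ∈ S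
    · exact (rav_contDiffAt_ravDbar (hg p (hSU h))).congr_of_eventuallyEq (haU p (hSU h))
    · exact contDiffAt_const.congr_of_eventuallyEq (haS' p h)
  have hbc : ContDiff ℝ (⊤ : ℕ∞) b := contDiff_iff_contDiffAt.2 fun p => by
    by_cases h : p ∈ S
    · exact (rav_contDiffAt_ravDt (hg p (hSU h))).congr_of_eventuallyEq (hbU p (hSU h))
    · exact contDiffAt_const.congr_of_eventuallyEq (hbS' p h)
  have hab : ∀ p, ravDt a p = ravDbar b p := fun p => by
    by_cases h : p ∈ S
    · rw [(rav_congr (haU p (hSU h))).1, (rav_congr (hbU p (hSU h))).2, rav_comm (hg p (hSU h))]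
    · rw [(rav_congr (haS' p h)).1, (rav_congr (hbS' p h)).2, (rav_zero p).1, (rav_zero p).2]
  obtain ⟨u, huc, hub, hu0⟩ := rav_primitive S hS T hT b hbc hbS
  have hDc : ContDiff ℝ (⊤ : ℕ∞) (ravDbar u) :=
    contDiff_iff_contDiffAt.2 fun p => rav_contDiffAt_ravDbar huc.contDiffAt
  have hua : ∀ p, ravDbar u p = a p := by
    have hd : ∀ p, DifferentiableAt ℝ (fun q => ravDbar u q - a q) p := fun p =>
      (hDc.differentiable (by simp) p).sub (hac.differentiable (by simp) p)
    have hz : ∀ p, ravDt (fun q => ravDbar u q - a q) p = 0 := fun p => by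
      rw [(rav_sub (hDc.differentiable (by simp) p) (hac.differentiable (by simp) p)).1,
        rav_comm huc.contDiffAt, hab, funext hub, sub_self]
    rintro ⟨z, t⟩
    have hder : ∀ s : ℝ, HasDerivAt (fun s : ℝ => ravDbar u (z, s) - a (z, s)) 0 s := fun s => by
      have := rav_slice_t (hd (z, s))
      rwa [hz] at this
    have hc := is_const_of_deriv_eq_zero (fun s => (hder s).differentiableAt)
      (fun s => (hder s).deriv) t (T - 1)
    have h1 : u =ᶠ[𝓝 (z, T - 1)] fun _ => 0 := by
      have : {p : ℂ × ℝ | p.2 < T} ∈ 𝓝 ((z, T - 1) : ℂ × ℝ) :=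
        (isOpen_lt continuous_snd continuous_const).mem_nhds (by simp)
      filter_upwards [this] with q hq using hu0 q hq
    have h2 : a (z, T - 1) = 0 := haS _ fun hm => by
      have := hT _ hm
      simp only at this
      linarith
    simp only [h2, (rav_congr h1).2, (rav_zero _).2, sub_zero] at hc
    exact sub_eq_zero.1 hc
  refine ⟨u, huc, hu0, fun p hp => ⟨?_, ?_⟩⟩
  · rw [hua, ha, indicator_of_mem hp]
  · rw [hub, hb, indicator_of_mem hp]

lemma rav_analytic {W : Set (ℂ × ℝ)} (hW : IsOpen W) {h : ℂ × ℝ → ℂ}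
    (hh : DPrimeClosedOn h W) : AnalyticOnNhd ℝ h W := by
  rintro ⟨z, t⟩ hp
  obtain ⟨r, hr, hrW⟩ := Metric.isOpen_iff.1 hW _ hp
  have hbox : ∀ w s, w ∈ Metric.ball z r → s ∈ Metric.ball t r → (w, s) ∈ W := fun w s hw hs =>
    hrW (by rw [← ball_prod_same]; exact ⟨hw, hs⟩)
  have ht : t ∈ Metric.ball t r := Metric.mem_ball_self hr
  have hd : DifferentiableOn ℂ (fun w => h (w, t)) (Metric.ball z r) := fun w hw => by
    obtain ⟨c, hc⟩ := (hh (w, t) (hbox w t hw ht)).1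
    exact hc.differentiableAt.differentiableWithinAt
  have han : AnalyticAt ℝ (fun w => h (w, t)) z :=
    (hd.analyticAt (Metric.ball_mem_nhds z hr)).restrictScalars
  have hcomp : AnalyticAt ℝ (fun q : ℂ × ℝ => h (q.1, t)) (z, t) :=
    AnalyticAt.fun_comp (g := fun w => h (w, t)) (f := Prod.fst) (x := (z, t)) han analyticAt_fst
  refine hcomp.congr ?_
  filter_upwards [Metric.ball_mem_nhds ((z, t) : ℂ × ℝ) hr] with q hq
  rw [← ball_prod_same] at hq
  obtain ⟨w, s⟩ := q
  have hder : ∀ s' ∈ Metric.ball t r, HasDerivAt (fun s : ℝ => h (w, s)) 0 s' := fun s' hs' =>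
    (hh (w, s') (hbox w s' hq.1 hs')).2
  exact Metric.isOpen_ball.is_const_of_deriv_eq_zero (convex_ball t r).isPreconnected
    (fun s' hs' => (hder s' hs').differentiableAt.differentiableWithinAt)
    (fun s' hs' => (hder s' hs').deriv) ht hq.2

lemma rav_cutoff (U K : Set (ℂ × ℝ)) (hU : IsOpen U) (hK : IsCompact K) (hKU : K ⊆ U) :
    ∃ (S : Set (ℂ × ℝ)) (χ : ℂ × ℝ → ℝ), IsCompact S ∧ K ⊆ S ∧ S ⊆ U ∧
      ContDiff ℝ (⊤ : ℕ∞) χ ∧ (∀ p ∈ K, ∀ᶠ q in 𝓝 p, χ q = 1) ∧ ∀ p ∉ S, χ p = 0 := by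
  obtain ⟨S, hS, hKS, hSU⟩ := exists_compact_between hK hU hKU
  obtain ⟨χ, h1, h0, -⟩ := exists_contMDiffMap_one_nhds_of_subset_interior
    (n := (⊤ : ℕ∞)) (modelWithCornersSelf ℝ (ℂ × ℝ)) hK.isClosed hKS
  refine ⟨S, χ, hS, hKS.trans interior_subset, hSU, χ.contMDiff.contDiff, fun p hp => ?_, h0⟩
  exact h1.filter_mono (nhds_le_nhdsSet hp)

/-- Raviolo Hartogs extension: a smooth `d′`-closed function on `U \ K` extends to a smooth
`d′`-closed function on `U`. -/
theorem raviolo_hartogs (U K : Set (ℂ × ℝ)) (hU : IsOpen U) (hK : IsCompact K)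
    (hKU : K ⊆ U) (hconn : IsConnected (U \ K)) (f : ℂ × ℝ → ℂ)
    (hf_smooth : ContDiffOn ℝ (⊤ : ℕ∞) f (U \ K)) (hf_closed : DPrimeClosedOn f (U \ K)) :
    ∃ F : ℂ × ℝ → ℂ, ContDiffOn ℝ (⊤ : ℕ∞) F U ∧ DPrimeClosedOn F U ∧ EqOn F f (U \ K) := by
  rcases K.eq_empty_or_nonempty with rfl | hKne
  · rw [sdiff_empty] at *
    exact ⟨f, hf_smooth, hf_closed, fun _ _ => rfl⟩
  have hW : IsOpen (U \ K) := hU.sdiff hK.isClosed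
  obtain ⟨S, χ, hS, hKS, hSU, hχ, hχ1, hχ0⟩ := rav_cutoff U K hU hK hKU
  obtain ⟨p₀, hp₀, hmin⟩ := hS.exists_isMinOn (hKne.mono hKS) continuous_snd.continuousOn
  have hT : ∀ p ∈ S, p₀.2 ≤ p.2 := fun p hp => hmin hp
  have hfat : ∀ p ∈ U \ K, ContDiffAt ℝ (⊤ : ℕ∞) f p := fun p hp =>
    hf_smooth.contDiffAt (hW.mem_nhds hp)
  set g : ℂ × ℝ → ℂ := fun p => (1 - χ p) • f p with hg
  have hgU : ∀ p ∈ U, ContDiffAt ℝ (⊤ : ℕ∞) g p := fun p hp => by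
    by_cases h : p ∈ K
    · refine (contDiffAt_const (c := (0 : ℂ))).congr_of_eventuallyEq ?_
      filter_upwards [hχ1 p h] with q hq
      simp [hg, hq]
    · exact (contDiffAt_const.sub hχ.contDiffAt).smul (hfat p ⟨hp, h⟩)
  have hgf : ∀ p ∉ S, g p = f p := fun p hp => by simp [hg, hχ0 p hp]
  have hg0 : ∀ p ∈ U \ S, ravDbar g p = 0 ∧ ravDt g p = 0 := fun p hp => by
    have e : g =ᶠ[𝓝 p] f := by
      filter_upwards [hS.isClosed.isOpen_compl.mem_nhds hp.2] with q hq using hgf q hq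
    have hpK : p ∈ U \ K := ⟨hp.1, fun h => hp.2 (hKS h)⟩
    rw [(rav_congr e).1, (rav_congr e).2]
    exact (rav_closed_iff ((hfat p hpK).differentiableAt (by simp))).1 (hf_closed p hpK)
  obtain ⟨u, huc, hu0, hug⟩ := rav_core U S hU hS hSU p₀.2 hT g hgU hg0
  have hFU : ∀ p ∈ U, ContDiffAt ℝ (⊤ : ℕ∞) (fun q => g q - u q) p := fun p hp =>
    (hgU p hp).sub huc.contDiffAt
  have hFc : DPrimeClosedOn (fun q => g q - u q) U := fun p hp => by
    refine (rav_closed_iff ((hFU p hp).differentiableAt (by simp))).2 ?_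
    have := rav_sub ((hgU p hp).differentiableAt (by simp)) (huc.differentiable (by simp) p)
    rw [this.1, this.2, (hug p hp).1, (hug p hp).2]
    simp
  refine ⟨fun q => g q - u q, fun p hp => (hFU p hp).contDiffWithinAt, hFc, ?_⟩
  have hlt : IsOpen {p : ℂ × ℝ | p.2 < p₀.2} := isOpen_lt continuous_snd continuous_const
  have hlow : ∀ p : ℂ × ℝ, p.2 < p₀.2 → p ∉ S := fun p hp hm => absurd (hT p hm) (not_le.2 hp)
  -- a point of `U` just below `p₀`
  obtain ⟨r, hr, hrU⟩ := Metric.isOpen_iff.1 hU p₀ (hSU hp₀)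
  have hq₁ : ((p₀.1, p₀.2 - r / 2) : ℂ × ℝ) ∈ U := hrU (by
    rw [← Prod.mk.eta (p := p₀), ← ball_prod_same]
    refine ⟨Metric.mem_ball_self hr, ?_⟩
    simp [Real.dist_eq, abs_of_pos hr, hr])
  have hq₂ : ((p₀.1, p₀.2 - r / 2) : ℂ × ℝ).2 < p₀.2 := by simp [hr]
  refine AnalyticOnNhd.eqOn_of_preconnected_of_eventuallyEq
    (rav_analytic hW fun p hp => hFc p hp.1) (rav_analytic hW hf_closed) hconn.isPreconnected
    (z₀ := (p₀.1, p₀.2 - r / 2)) ⟨hq₁, fun h => hlow _ hq₂ (hKS h)⟩ ?_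
  filter_upwards [hlt.mem_nhds hq₂] with q hq
  rw [hgf q (hlow q hq), hu0 q hq, sub_zero]
end

section
/- Degree-zero Dolbeault–de Rham cohomology of the punctured space (Theorem 1.1, degree-zero part for p = 0): For every smooth d′-closed function f : (ℂ × ℝ) ∖ {(0,0)} → ℂ there is a unique entire holomorphic function g : ℂ → ℂ such that f(z,t) = g(z) for all (z,t) ≠ (0,0). Consequently, pullback along the composition (ℂ × ℝ) ∖ {0} ↪ ℂ × ℝ → ℂ identifies entire functions on ℂ with smooth d′-closed functions on the punctured space. -/
open Set

/-- The degree-zero Dolbeault–de Rham cohomology of the punctured space `(ℂ × ℝ) ∖ {0}`: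
every smooth `d′`-closed function on the punctured space is the pullback of a unique entire
function along the projection `(z, t) ↦ z`, and conversely every entire function pulls back
to a smooth `d′`-closed function. -/
theorem degree_zero_cohomology_punctured :
    (∀ f : ℂ × ℝ → ℂ,
      ContDiffOn ℝ (⊤ : ℕ∞) f {p : ℂ × ℝ | p ≠ (0, 0)} →
      DPrimeClosedOn f {p : ℂ × ℝ | p ≠ (0, 0)} →
      ∃! g : ℂ → ℂ, Differentiable ℂ g ∧ ∀ p : ℂ × ℝ, p ≠ (0, 0) → f p = g p.1) ∧
    (∀ g : ℂ → ℂ, Differentiable ℂ g →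
      ContDiffOn ℝ (⊤ : ℕ∞) (fun p : ℂ × ℝ => g p.1) {p : ℂ × ℝ | p ≠ (0, 0)} ∧
      DPrimeClosedOn (fun p : ℂ × ℝ => g p.1) {p : ℂ × ℝ | p ≠ (0, 0)}) := by
  constructor
  · intro f _ hf
    have hne : ∀ (z : ℂ) (t : ℝ), z ≠ 0 → f (z, t) = f (z, 1) := by
      intro z t hz
      have hd : ∀ s : ℝ, HasDerivAt (fun s : ℝ => f (z, s)) 0 s := fun s =>
        (hf (z, s) (by simp [hz])).2
      exact is_const_of_deriv_eq_zero (f := fun s : ℝ => f (z, s))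
        (fun s => (hd s).differentiableAt) (fun s => (hd s).deriv) t 1
    have hdiff : ∀ t : ℝ, t ≠ 0 → Differentiable ℂ (fun w : ℂ => f (w, t)) := by
      intro t ht z
      obtain ⟨c, hc⟩ := (hf (z, t) (by simp [ht])).1
      exact hc.differentiableAt
    refine ⟨fun z => f (z, 1), ⟨hdiff 1 one_ne_zero, ?_⟩, ?_⟩
    · rintro ⟨z, t⟩ hp
      by_cases hz : z = 0
      · have ht : t ≠ 0 := by
          rintro rfl
          exact hp (by rw [hz])
        have hE : (fun w : ℂ => f (w, t)) = fun w : ℂ => f (w, 1) :=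
          Continuous.ext_on (dense_compl_singleton (0 : ℂ)) (hdiff t ht).continuous
            (hdiff 1 one_ne_zero).continuous (fun w hw => hne w t hw)
        exact congrFun hE z
      · exact hne z t hz
    · rintro g ⟨_, hg⟩
      funext z
      exact (hg (z, 1) (by simp)).symm
  · intro g hg
    constructor
    · have h1 : ContDiff ℝ (⊤ : ℕ∞) g := (hg.contDiff (n := ((⊤ : ℕ∞) : WithTop ℕ∞))).restrict_scalars ℝ
      exact (h1.comp contDiff_fst).contDiffOn
    · intro p _
      exact ⟨⟨_, (hg p.1).hasDerivAt⟩, hasDerivAt_const p.2 (g p.1)⟩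
end

section
/- Cohomology of the algebraic model of the raviolo (Proposition 1.5): Let R = ℂ[z,λ,x]/(zλ + x² − 1) with the derivation e induced by z ∂/∂x − 2x ∂/∂λ. Then: (a) the kernel of e : R → R equals the image of ℂ[z] under the quotient map, i.e. a class f ∈ R satisfies e(f) = 0 if and only if f is represented by a polynomial in z alone; (b) the composite ℂ[λ] → R → R/e(R) is a ℂ-linear isomorphism, i.e. R = e(R) ⊕ span_ℂ{λ^n : n ≥ 0}. Consequently the two-term complex 𝒜 = (R → Rω) with differential d′(f) = −½ e(f) ω has cohomology concentrated in degrees 0 and 1, with H⁰(𝒜) = ℂ[z] and H¹(𝒜) = ℂ[λ]ω. -/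
open MvPolynomial

noncomputable section

/-- The defining ideal `(zλ + x² − 1)` of the algebraic model of the raviolo, with
`z = X 0`, `λ = X 1`, `x = X 2`. -/
def RavPolyIdeal : Ideal (MvPolynomial (Fin 3) ℂ) :=
  Ideal.span {X 0 * X 1 + X 2 ^ 2 - 1}

/-- The ring `R = ℂ[z,λ,x]/(zλ + x² − 1)`. -/
abbrev RavR := MvPolynomial (Fin 3) ℂ ⧸ RavPolyIdeal

/-- The derivation `e = z ∂/∂x − 2x ∂/∂λ` on `ℂ[z,λ,x]`. -/
def ePoly (p : MvPolynomial (Fin 3) ℂ) : MvPolynomial (Fin 3) ℂ :=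
  X 0 * pderiv 2 p - 2 * X 2 * pderiv 1 p

namespace RavAux

/-- The ring `ℂ[λ][z]`. -/
abbrev S := Polynomial (Polynomial ℂ)

/-- The partial derivative with respect to `λ`, as a function. -/
def dl0 (a : S) : S :=
  ∑ i ∈ a.support, Polynomial.monomial i (Polynomial.derivative (a.coeff i))

theorem coeff_dl0 (a : S) (n : ℕ) : (dl0 a).coeff n = Polynomial.derivative (a.coeff n) := by
  rw [dl0, Polynomial.finsetSum_coeff]
  simp only [Polynomial.coeff_monomial]
  rw [Finset.sum_ite_eq' a.support n]
  split_ifs with h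
  · rfl
  · rw [Polynomial.notMem_support_iff.1 h, map_zero]

/-- The partial derivative with respect to `λ`. -/
def dl : S →+ S where
  toFun := dl0
  map_zero' := by ext1 n; rw [coeff_dl0]; simp
  map_add' a b := by ext1 n; simp only [coeff_dl0, Polynomial.coeff_add, map_add]

theorem coeff_dl (a : S) (n : ℕ) : (dl a).coeff n = Polynomial.derivative (a.coeff n) :=
  coeff_dl0 a n

/-- The operator `b ↦ z b + 2 (z λ - 1) ∂b/∂λ`. -/
def L (b : S) : S :=
  Polynomial.X * b + 2 * (Polynomial.X * (Polynomial.C Polynomial.X * dl b) - dl b)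

theorem L_add (a b : S) : L (a + b) = L a + L b := by
  simp only [L, map_add]; ring

theorem L_zero : L 0 = 0 := by simp [L]

theorem coeff_L (b : S) (n : ℕ) : (L b).coeff (n + 1) =
    (b.coeff n + 2 * Polynomial.X * Polynomial.derivative (b.coeff n))
      - 2 * Polynomial.derivative (b.coeff (n + 1)) := by
  have h2 : (2 : S) = Polynomial.C 2 := (map_ofNat Polynomial.C 2).symm
  rw [L, h2, Polynomial.coeff_add, Polynomial.coeff_X_mul, Polynomial.coeff_C_mul,
    Polynomial.coeff_sub, Polynomial.coeff_X_mul, Polynomial.coeff_C_mul, coeff_dl, coeff_dl]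
  ring

theorem D_inj (q : Polynomial ℂ) (h : q + 2 * Polynomial.X * Polynomial.derivative q = 0) :
    q = 0 := by
  ext n
  have h1 := congrArg (fun r => Polynomial.coeff r n) h
  have h2 : (2 : Polynomial ℂ) = Polynomial.C 2 := (map_ofNat Polynomial.C 2).symm
  simp only [Polynomial.coeff_add, mul_assoc, h2, Polynomial.coeff_C_mul,
    Polynomial.coeff_zero] at h1
  rw [Polynomial.coeff_zero]
  cases n with
  | zero => simpa using h1
  | succ n =>
    rw [Polynomial.coeff_X_mul, Polynomial.coeff_derivative] at h1
    have h3 : q.coeff (n + 1) * ((2 * n + 3 : ℕ) : ℂ) = 0 := by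
      rw [← h1]; push_cast; ring
    rcases mul_eq_zero.1 h3 with h | h
    · exact h
    · exact absurd h (by exact_mod_cast (by omega : 2 * n + 3 ≠ 0))

theorem D_surj (q : Polynomial ℂ) :
    ∃ r : Polynomial ℂ, r + 2 * Polynomial.X * Polynomial.derivative r = q := by
  induction q using Polynomial.induction_on' with
  | add p q hp hq =>
    obtain ⟨r, rfl⟩ := hp
    obtain ⟨s, rfl⟩ := hq
    exact ⟨r + s, by rw [Polynomial.derivative_add]; ring⟩
  | monomial n c =>
    have hn : ((2 * n + 1 : ℕ) : ℂ) ≠ 0 := by exact_mod_cast (by omega : 2 * n + 1 ≠ 0)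
    refine ⟨Polynomial.monomial n (c / ((2 * n + 1 : ℕ) : ℂ)), ?_⟩
    have h2 : (2 : Polynomial ℂ) = Polynomial.C 2 := (map_ofNat Polynomial.C 2).symm
    rw [Polynomial.derivative_monomial, h2]
    cases n with
    | zero => simp
    | succ n =>
      rw [Nat.add_sub_cancel, mul_assoc, Polynomial.X_mul_monomial, Polynomial.C_mul_monomial,
        ← map_add]
      congr 1
      field_simp
      push_cast
      ring

theorem der_surj (q : Polynomial ℂ) : ∃ r : Polynomial ℂ, Polynomial.derivative r = q := by
  induction q using Polynomial.induction_on' with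
  | add p q hp hq =>
    obtain ⟨r, rfl⟩ := hp
    obtain ⟨s, rfl⟩ := hq
    exact ⟨r + s, by rw [Polynomial.derivative_add]⟩
  | monomial n c =>
    have hn : ((n : ℂ) + 1) ≠ 0 := by exact_mod_cast Nat.succ_ne_zero n
    refine ⟨Polynomial.monomial (n + 1) (c / ((n : ℂ) + 1)), ?_⟩
    rw [Polynomial.derivative_monomial]
    congr 1
    push_cast
    field_simp

theorem dl_monomial (n : ℕ) (q : Polynomial ℂ) :
    dl (Polynomial.monomial n q) = Polynomial.monomial n (Polynomial.derivative q) := by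
  ext1 m
  rw [coeff_dl, Polynomial.coeff_monomial, Polynomial.coeff_monomial]
  split_ifs <;> simp

theorem dl_surj (a : S) : ∃ b, dl b = a := by
  induction a using Polynomial.induction_on' with
  | add p q hp hq =>
    obtain ⟨r, rfl⟩ := hp
    obtain ⟨s, rfl⟩ := hq
    exact ⟨r + s, by rw [map_add]⟩
  | monomial n c =>
    obtain ⟨r, rfl⟩ := der_surj c
    exact ⟨Polynomial.monomial n r, dl_monomial n r⟩

theorem L_inj (b : S) (q : Polynomial ℂ) (h : L b = Polynomial.C q) : b = 0 := by
  have h1 := coeff_L b b.natDegree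
  rw [h, Polynomial.coeff_C_succ,
    Polynomial.coeff_eq_zero_of_natDegree_lt (Nat.lt_succ_self b.natDegree)] at h1
  simp only [map_zero, mul_zero, sub_zero] at h1
  exact Polynomial.leadingCoeff_eq_zero.1 (D_inj _ h1.symm)

theorem L_surj (a : S) : ∃ (b : S) (q : Polynomial ℂ), a = L b + Polynomial.C q := by
  induction a using Polynomial.induction_on' with
  | add p q hp hq =>
    obtain ⟨b, r, rfl⟩ := hp
    obtain ⟨c, s, rfl⟩ := hq
    exact ⟨b + c, r + s, by rw [L_add, map_add]; ring⟩
  | monomial n c =>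
    induction n generalizing c with
    | zero => exact ⟨0, c, by simp [L_zero]⟩
    | succ n ih =>
      obtain ⟨r, rfl⟩ := D_surj c
      obtain ⟨b, s, hb⟩ := ih (2 * Polynomial.derivative r)
      refine ⟨Polynomial.monomial n r + b, s, ?_⟩
      rw [L_add, add_assoc, ← hb, L, dl_monomial]
      have h2 : (2 : S) = Polynomial.C 2 := (map_ofNat Polynomial.C 2).symm
      rw [h2, Polynomial.C_mul_monomial, Polynomial.X_mul_monomial, Polynomial.X_mul_monomial,
        mul_sub, Polynomial.C_mul_monomial, Polynomial.C_mul_monomial, map_add, mul_assoc]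
      ring

/-- The inclusion `ℂ[λ][z] → ℂ[z,λ,x]`. -/
def P : S →+* MvPolynomial (Fin 3) ℂ :=
  Polynomial.eval₂RingHom (Polynomial.aeval (X 1)).toRingHom (X 0)

theorem P_C (q : Polynomial ℂ) : P (Polynomial.C q) = Polynomial.aeval (X 1) q := by
  simp [P]

theorem P_X : P Polynomial.X = X 0 := by
  simp [P]

theorem P_map (q : Polynomial ℂ) : P (q.map Polynomial.C) = Polynomial.aeval (X 0) q := by
  induction q using Polynomial.induction_on' with
  | add p q hp hq => rw [Polynomial.map_add, map_add, hp, hq, map_add]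
  | monomial n c =>
    simp [P]

theorem pd1 (q : Polynomial ℂ) : pderiv 1 (Polynomial.aeval (X 1 : MvPolynomial (Fin 3) ℂ) q) =
    Polynomial.aeval (X 1) (Polynomial.derivative q) := by
  rw [Derivation.map_aeval]; simp

theorem pd2 (q : Polynomial ℂ) :
    pderiv 2 (Polynomial.aeval (X 1 : MvPolynomial (Fin 3) ℂ) q) = 0 := by
  rw [Derivation.map_aeval, pderiv_X_of_ne (by decide)]; simp

theorem P_monomial (n : ℕ) (q : Polynomial ℂ) :
    P (Polynomial.monomial n q) = Polynomial.aeval (X 1) q * X 0 ^ n := by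
  simp [P]

theorem pderiv1_P (a : S) : pderiv 1 (P a) = P (dl a) := by
  induction a using Polynomial.induction_on' with
  | add p q hp hq => simp only [map_add, hp, hq]
  | monomial n c =>
    rw [dl_monomial, P_monomial, P_monomial, Derivation.leibniz, pd1, Derivation.leibniz_pow,
      pderiv_X_of_ne (by decide)]
    simp [mul_comm]

theorem pderiv2_P (a : S) : pderiv 2 (P a) = 0 := by
  induction a using Polynomial.induction_on' with
  | add p q hp hq => simp only [map_add, hp, hq, add_zero]
  | monomial n c =>
    rw [P_monomial, Derivation.leibniz, pd2, Derivation.leibniz_pow,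
      pderiv_X_of_ne (by decide)]
    simp

/-- The class of `a + x b`. -/
def M (a b : S) : RavR := Ideal.Quotient.mk RavPolyIdeal (P a + X 2 * P b)

theorem mk_rel (p q r : MvPolynomial (Fin 3) ℂ)
    (h : p - q = r * (X 0 * X 1 + X 2 ^ 2 - 1)) :
    Ideal.Quotient.mk RavPolyIdeal p = Ideal.Quotient.mk RavPolyIdeal q := by
  rw [Ideal.Quotient.eq, h]
  exact Ideal.mul_mem_left _ _ (Ideal.subset_span rfl)

theorem e_M (a b : S) : Ideal.Quotient.mk RavPolyIdeal (ePoly (P a + X 2 * P b)) =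
    M (L b) (-2 * dl a) := by
  refine mk_rel _ _ (-2 * P (dl b)) ?_
  simp only [ePoly, L, map_add, map_sub, map_mul, map_neg, Derivation.leibniz, pderiv1_P,
    pderiv2_P, P_X, P_C, pderiv_X_self, map_ofNat, Polynomial.aeval_X,
    pderiv_X_of_ne (show (2 : Fin 3) ≠ 1 by decide), smul_eq_mul]
  ring

theorem M_surj (f : RavR) : ∃ a b, f = M a b := by
  obtain ⟨p, rfl⟩ := Ideal.Quotient.mk_surjective f
  induction p using MvPolynomial.induction_on with
  | C c => exact ⟨Polynomial.C (Polynomial.C c), 0, by simp [M, P_C]⟩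
  | add p q hp hq =>
    obtain ⟨a, b, h⟩ := hp
    obtain ⟨c, d, h'⟩ := hq
    refine ⟨a + c, b + d, ?_⟩
    rw [map_add, h, h', M, M, M, ← map_add]
    congr 1
    simp only [map_add]; ring
  | mul_X p i hp =>
    obtain ⟨a, b, h⟩ := hp
    rw [map_mul, h, M, ← map_mul]
    fin_cases i
    · refine ⟨a * Polynomial.X, b * Polynomial.X, ?_⟩
      rw [M]; congr 1; simp only [map_mul, P_X, Fin.zero_eta]; ring
    · refine ⟨a * Polynomial.C Polynomial.X, b * Polynomial.C Polynomial.X, ?_⟩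
      rw [M]; congr 1; simp only [map_mul, P_C, Polynomial.aeval_X, Fin.mk_one]; ring
    · refine ⟨b * (1 - Polynomial.X * Polynomial.C Polynomial.X), a, mk_rel _ _ (P b) ?_⟩
      simp only [map_mul, map_sub, map_one, P_C, P_X, Polynomial.aeval_X, Fin.reduceFinMk]; ring

/-- The model `S[x]/(x² = 1 - zλ)`. -/
abbrev T := QuadraticAlgebra S (1 - Polynomial.X * Polynomial.C Polynomial.X) 0

/-- The evaluation map to the model. -/
def ev : MvPolynomial (Fin 3) ℂ →+* T :=
  eval₂Hom ((algebraMap S T).comp (Polynomial.C.comp Polynomial.C))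
    ![algebraMap S T Polynomial.X, algebraMap S T (Polynomial.C Polynomial.X), ⟨0, 1⟩]

theorem ev_P (a : S) : ev (P a) = algebraMap S T a := by
  have : ev.comp P = algebraMap S T := by
    refine Polynomial.ringHom_ext' (Polynomial.ringHom_ext' ?_ ?_) ?_
    · ext c : 1
      simp [P_C, ev, MvPolynomial.algebraMap_eq]
    · simp [P_C, ev]
    · simp [P_X, ev]
  exact RingHom.congr_fun this a

theorem ev_rel : ev (X 0 * X 1 + X 2 ^ 2 - 1) = 0 := by
  simp only [ev, map_sub, map_add, map_mul, map_pow, map_one, coe_eval₂Hom, eval₂_X]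
  ext1 <;> simp [pow_two, QuadraticAlgebra.re_one, QuadraticAlgebra.im_one]

theorem M_inj (a b c d : S) (h : M a b = M c d) : a = c ∧ b = d := by
  rw [M, M, Ideal.Quotient.eq, RavPolyIdeal, Ideal.mem_span_singleton] at h
  obtain ⟨r, hr⟩ := h
  have h1 := congrArg ev hr
  rw [map_mul, ev_rel, zero_mul, map_sub, sub_eq_zero] at h1
  have hx : ev (X 2) = ⟨0, 1⟩ := by simp [ev]
  simp only [map_add, map_mul, ev_P, hx] at h1
  constructor
  · simpa using congrArg QuadraticAlgebra.re h1
  · simpa using congrArg QuadraticAlgebra.im h1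

theorem M_add (a b c d : S) : M a b + M c d = M (a + c) (b + d) := by
  rw [M, M, M, ← map_add]; congr 1; simp only [map_add]; ring

theorem dl_ker (a : S) (h : dl a = 0) : ∃ q : Polynomial ℂ, a = q.map Polynomial.C := by
  refine ⟨a.map (Polynomial.evalRingHom 0), ?_⟩
  ext1 n
  have h1 : Polynomial.derivative (a.coeff n) = 0 := by rw [← coeff_dl, h, Polynomial.coeff_zero]
  have h2 := Polynomial.eq_C_of_derivative_eq_zero h1
  rw [Polynomial.coeff_map, Polynomial.coeff_map, h2]
  simp

theorem dl_map (q : Polynomial ℂ) : dl (q.map Polynomial.C) = 0 := by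
  ext1 n
  rw [coeff_dl, Polynomial.coeff_map]; simp

theorem M_C (q : Polynomial ℂ) :
    Ideal.Quotient.mk RavPolyIdeal (Polynomial.aeval (X 1) q) = M (Polynomial.C q) 0 := by
  simp [M, P_C]

theorem M_z (q : Polynomial ℂ) :
    Ideal.Quotient.mk RavPolyIdeal (Polynomial.aeval (X 0) q) = M (q.map Polynomial.C) 0 := by
  simp [M, P_map]

theorem aeval_mem_span (q : Polynomial ℂ) :
    Ideal.Quotient.mk RavPolyIdeal (Polynomial.aeval (X 1) q) ∈
      Submodule.span ℂ (Set.range fun n : ℕ => Ideal.Quotient.mk RavPolyIdeal (X 1 ^ n)) := by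
  induction q using Polynomial.induction_on' with
  | add p q hp hq => rw [map_add, map_add]; exact add_mem hp hq
  | monomial n c =>
    rw [Polynomial.aeval_monomial, ← Algebra.smul_def]
    have h := Submodule.smul_mem (Submodule.span ℂ (Set.range fun n : ℕ =>
      Ideal.Quotient.mk RavPolyIdeal (X 1 ^ n))) c (Submodule.subset_span (Set.mem_range_self n))
    exact h

theorem span_le (f : RavR)
    (hf : f ∈ Submodule.span ℂ
      (Set.range fun n : ℕ => Ideal.Quotient.mk RavPolyIdeal (X 1 ^ n))) :
    ∃ q : Polynomial ℂ, f = Ideal.Quotient.mk RavPolyIdeal (Polynomial.aeval (X 1) q) := by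
  induction hf using Submodule.span_induction with
  | mem x hx =>
    obtain ⟨n, rfl⟩ := hx
    exact ⟨Polynomial.X ^ n, by simp⟩
  | zero => exact ⟨0, by simp⟩
  | add x y _ _ hx hy =>
    obtain ⟨p, rfl⟩ := hx
    obtain ⟨q, rfl⟩ := hy
    exact ⟨p + q, by simp⟩
  | smul c x _ hx =>
    obtain ⟨p, rfl⟩ := hx
    exact ⟨c • p, by rw [map_smul]; rfl⟩

end RavAux

open RavAux

/-- Cohomology of the algebraic model of the raviolo (Proposition 1.5):
for the derivation `e` on `R = ℂ[z,λ,x]/(zλ + x² − 1)` induced by `z ∂/∂x − 2x ∂/∂λ`,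
(a) the kernel of `e` is exactly the image of `ℂ[z]`;
(b) the composite `ℂ[λ] → R → R/e(R)` is a linear isomorphism, i.e. `R` is the direct sum
of `e(R)` and the span of the classes of the `λ^n`.  Hence the two-term complex
`(R → Rω, d′ = −½ e ⊗ ω)` has `H⁰ = ℂ[z]` and `H¹ = ℂ[λ]ω`. -/
theorem raviolo_model_cohomology (e : RavR →ₗ[ℂ] RavR)
    (he : ∀ p : MvPolynomial (Fin 3) ℂ,
      e (Ideal.Quotient.mk RavPolyIdeal p) = Ideal.Quotient.mk RavPolyIdeal (ePoly p)) :
    (∀ f : RavR, e f = 0 ↔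
      ∃ q : Polynomial ℂ, f = Ideal.Quotient.mk RavPolyIdeal (Polynomial.aeval (X 0) q)) ∧
    (Function.Bijective fun q : Polynomial ℂ =>
      Submodule.mkQ (LinearMap.range e)
        (Ideal.Quotient.mk RavPolyIdeal (Polynomial.aeval (X 1) q))) ∧
    IsCompl (LinearMap.range e)
      (Submodule.span ℂ (Set.range fun n : ℕ => Ideal.Quotient.mk RavPolyIdeal (X 1 ^ n))) := by
  have heM : ∀ a b : S, e (M a b) = M (L b) (-2 * dl a) := fun a b => by
    rw [← e_M, ← he]; rfl
  have hM0 : M 0 0 = 0 := by simp [M]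
  have hzero : ∀ q : Polynomial ℂ,
      Ideal.Quotient.mk RavPolyIdeal (Polynomial.aeval (X 1) q) ∈ LinearMap.range e → q = 0 := by
    rintro q ⟨f, hf⟩
    obtain ⟨a, b, rfl⟩ := M_surj f
    rw [heM, M_C] at hf
    have h1 := (M_inj _ _ _ _ hf).1
    have h2 := L_inj b q h1
    rw [h2, L_zero] at h1
    exact Polynomial.C_eq_zero.1 h1.symm
  have hdec : ∀ f : RavR, ∃ g : RavR, ∃ q : Polynomial ℂ,
      f = e g + Ideal.Quotient.mk RavPolyIdeal (Polynomial.aeval (X 1) q) := by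
    intro f
    obtain ⟨a, b, rfl⟩ := M_surj f
    obtain ⟨b', q, rfl⟩ := L_surj a
    obtain ⟨a', ha'⟩ := dl_surj (Polynomial.C (Polynomial.C (-1 / 2)) * b)
    refine ⟨M a' b', q, ?_⟩
    rw [heM, M_C, M_add, ha', add_zero, ← mul_assoc]
    have h2 : (-2 : S) = Polynomial.C (Polynomial.C (-2)) := by
      rw [map_neg, map_neg, map_ofNat, map_ofNat]
    rw [h2, ← Polynomial.C_mul, ← Polynomial.C_mul]
    norm_num
  refine ⟨fun f => ⟨fun h => ?_, ?_⟩, ⟨fun p q h => ?_, fun f => ?_⟩, ?_, ?_⟩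
  · obtain ⟨a, b, rfl⟩ := M_surj f
    rw [heM, ← hM0] at h
    obtain ⟨h1, h2⟩ := M_inj _ _ _ _ h
    have hb : b = 0 := L_inj b 0 (by rw [h1, map_zero])
    have ha : dl a = 0 := by
      rcases mul_eq_zero.1 h2 with h | h
      · exact absurd h (by simp)
      · exact h
    obtain ⟨q, rfl⟩ := dl_ker a ha
    exact ⟨q, by rw [M_z, hb]⟩
  · rintro ⟨q, rfl⟩
    rw [M_z, heM, dl_map, L_zero, mul_zero, hM0]
  · have h' := (Submodule.Quotient.eq _).1 h
    rw [← map_sub, ← map_sub] at h'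
    exact sub_eq_zero.1 (hzero _ h')
  · obtain ⟨f, rfl⟩ := Submodule.mkQ_surjective _ f
    obtain ⟨g, q, rfl⟩ := hdec f
    refine ⟨q, ?_⟩
    refine ((Submodule.Quotient.eq _).2 ?_)
    exact ⟨-g, by rw [map_neg]; ring⟩
  · rw [Submodule.disjoint_def]
    intro f hf hs
    obtain ⟨q, rfl⟩ := span_le f hs
    rw [hzero q hf]; simp
  · rw [codisjoint_iff, eq_top_iff]
    intro f _
    obtain ⟨g, q, rfl⟩ := hdec f
    exact Submodule.add_mem_sup ⟨g, rfl⟩ (aeval_mem_span q)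
end
end

section
/- The algebraic model embeds into the Dolbeault–de Rham complex of the punctured space (Proposition 1.6): On X = (ℂ × ℝ) ∖ {0} set r = (|z|² + t²)^{1/2}, jλ = z̄/r², jx = t/r, ω_{z̄} = t/r³, ω_t = −2z̄/r³. Then: (a) z·jλ + (jx)² = 1 identically on X, so the assignment z ↦ z, λ ↦ jλ, x ↦ jx extends to a ℂ-algebra homomorphism j : R = ℂ[z,λ,x]/(zλ + x² − 1) → C^∞(X, ℂ); (b) j is injective; (c) j is a cochain map: ∂_{z̄}(jλ) = jx·ω_{z̄}, ∂_t(jλ) = jx·ω_t, ∂_{z̄}(jx) = −½ z ω_{z̄}, ∂_t(jx) = −½ z ω_t, and the one-form ω(z̲;0) = ω_{z̄} dz̄ + ω_t dt is d′-closed, i.e. ∂_{z̄} ω_t = ∂_t ω_{z̄} on X. -/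
open Complex MvPolynomial

noncomputable section

/-- The Wirtinger derivative `∂/∂ū = ½(∂/∂x₁ + i ∂/∂x₂)` of a function `g : ℂ → ℂ` at a
point `u = x₁ + i x₂`. -/
def wirtingerBar (g : ℂ → ℂ) (u : ℂ) : ℂ :=
  (1 / 2) * (deriv (fun x : ℝ => g ((x : ℂ) + (u.im : ℂ) * I)) u.re
    + I * deriv (fun y : ℝ => g ((u.re : ℂ) + (y : ℂ) * I)) u.im)

/-- `j(λ) = z̄ / r²` with `r² = |z|² + t²`. -/
def jlam (p : ℂ × ℝ) : ℂ := (starRingEnd ℂ p.1) / (((normSq p.1 + p.2 ^ 2 : ℝ)) : ℂ)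

/-- `j(x) = t / r`. -/
def jx (p : ℂ × ℝ) : ℂ := ((p.2 / Real.sqrt (normSq p.1 + p.2 ^ 2) : ℝ) : ℂ)

/-- The `dz̄`-component `t / r³` of the one-form `ω(z̲;0)`. -/
def omZbar (p : ℂ × ℝ) : ℂ :=
  ((p.2 : ℝ) : ℂ) / ((((normSq p.1 + p.2 ^ 2) ^ ((3 : ℝ) / 2) : ℝ)) : ℂ)

/-- The `dt`-component `−2 z̄ / r³` of the one-form `ω(z̲;0)`. -/
def omT (p : ℂ × ℝ) : ℂ :=
  (-2 * starRingEnd ℂ p.1) / ((((normSq p.1 + p.2 ^ 2) ^ ((3 : ℝ) / 2) : ℝ)) : ℂ)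

/-- The radius `r`. -/
def rr (p : ℂ × ℝ) : ℝ := Real.sqrt (normSq p.1 + p.2 ^ 2)

lemma rr_arg_pos (p : ℂ × ℝ) (hp : p ≠ (0, 0)) : 0 < normSq p.1 + p.2 ^ 2 := by
  rcases p with ⟨z, t⟩
  by_cases hz : z = 0
  · have ht : t ≠ 0 := by
      rintro rfl
      exact hp (by rw [hz])
    have := normSq_nonneg z
    positivity
  · have := normSq_pos.2 hz
    positivity

lemma rr_pos (p : ℂ × ℝ) (hp : p ≠ (0, 0)) : 0 < rr p := Real.sqrt_pos.2 (rr_arg_pos p hp)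

lemma rr_arg_nonneg (p : ℂ × ℝ) : 0 ≤ normSq p.1 + p.2 ^ 2 := by
  have := normSq_nonneg p.1
  positivity

lemma rr_sq (p : ℂ × ℝ) : rr p ^ 2 = normSq p.1 + p.2 ^ 2 := Real.sq_sqrt (rr_arg_nonneg p)

lemma rr_cube (p : ℂ × ℝ) : (normSq p.1 + p.2 ^ 2) ^ ((3 : ℝ) / 2) = rr p ^ 3 := by
  rw [Real.rpow_div_two_eq_sqrt _ (rr_arg_nonneg p), rr]
  exact_mod_cast Real.rpow_natCast _ 3

lemma jlam_eq (p : ℂ × ℝ) : jlam p = (starRingEnd ℂ p.1) / (rr p : ℂ) ^ 2 := by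
  rw [jlam, ← rr_sq]; push_cast; rfl

lemma jx_eq (p : ℂ × ℝ) : jx p = (p.2 : ℂ) / (rr p : ℂ) := by
  rw [jx, ← rr]; push_cast; rfl

lemma omZbar_eq (p : ℂ × ℝ) : omZbar p = (p.2 : ℂ) / (rr p : ℂ) ^ 3 := by
  rw [omZbar, rr_cube]; push_cast; rfl

lemma omT_eq (p : ℂ × ℝ) : omT p = (-2 * starRingEnd ℂ p.1) / (rr p : ℂ) ^ 3 := by
  rw [omT, rr_cube]; push_cast; rfl

lemma rr_sq_C (z : ℂ) (t : ℝ) :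
    (rr (z, t) : ℂ) ^ 2 = (z.re : ℂ) ^ 2 + (z.im : ℂ) ^ 2 + (t : ℂ) ^ 2 := by
  have := rr_sq (z, t)
  rw [normSq_apply] at this
  have h2 : ((rr (z, t) ^ 2 : ℝ) : ℂ) = ((z.re * z.re + z.im * z.im + t ^ 2 : ℝ) : ℂ) := by
    rw [this]
  push_cast at h2
  rw [h2]; ring

lemma part_a (p : ℂ × ℝ) (hp : p ≠ (0, 0)) : p.1 * jlam p + (jx p) ^ 2 = 1 := by
  have h := rr_pos p hp
  have h' : (rr p : ℂ) ≠ 0 := by exact_mod_cast h.ne'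
  rw [jlam_eq, jx_eq]
  have h2 : ((rr p : ℂ)) ^ 2 = p.1 * starRingEnd ℂ p.1 + (p.2 : ℂ) ^ 2 := by
    rw [mul_conj]
    exact_mod_cast rr_sq p
  field_simp
  rw [h2]

lemma contDiff_normSq' : ContDiff ℝ (⊤ : ℕ∞) (fun p : ℂ × ℝ => normSq p.1 + p.2 ^ 2) := by
  have h : (fun p : ℂ × ℝ => normSq p.1 + p.2 ^ 2) =
      fun p : ℂ × ℝ => reCLM p.1 * reCLM p.1 + imCLM p.1 * imCLM p.1 + p.2 ^ 2 := by
    funext p; simp [normSq_apply]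
  rw [h]
  fun_prop

lemma contDiff_rr : ContDiffOn ℝ (⊤ : ℕ∞) rr {p : ℂ × ℝ | p ≠ (0, 0)} :=
  contDiff_normSq'.contDiffOn.sqrt fun p hp => (rr_arg_pos p hp).ne'

lemma contDiff_rrC : ContDiffOn ℝ (⊤ : ℕ∞) (fun p => (rr p : ℂ)) {p : ℂ × ℝ | p ≠ (0, 0)} :=
  ofRealCLM.contDiff.comp_contDiffOn contDiff_rr

lemma contDiff_conj' : ContDiff ℝ (⊤ : ℕ∞) (fun p : ℂ × ℝ => starRingEnd ℂ p.1) :=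
  (conjCLE : ℂ ≃L[ℝ] ℂ).contDiff.comp contDiff_fst

lemma contDiff_t' : ContDiff ℝ (⊤ : ℕ∞) (fun p : ℂ × ℝ => (p.2 : ℂ)) :=
  ofRealCLM.contDiff.comp contDiff_snd

lemma part_smooth : ContDiffOn ℝ (⊤ : ℕ∞) jlam {p : ℂ × ℝ | p ≠ (0, 0)} ∧
      ContDiffOn ℝ (⊤ : ℕ∞) jx {p : ℂ × ℝ | p ≠ (0, 0)} ∧
      ContDiffOn ℝ (⊤ : ℕ∞) omZbar {p : ℂ × ℝ | p ≠ (0, 0)} ∧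
      ContDiffOn ℝ (⊤ : ℕ∞) omT {p : ℂ × ℝ | p ≠ (0, 0)} := by
  have hne : ∀ p ∈ {p : ℂ × ℝ | p ≠ (0, 0)}, (rr p : ℂ) ≠ 0 := fun p hp => by
    exact_mod_cast (rr_pos p hp).ne'
  have e1 : jlam = _ := funext jlam_eq
  have e2 : jx = _ := funext jx_eq
  have e3 : omZbar = _ := funext omZbar_eq
  have e4 : omT = _ := funext omT_eq
  rw [e1, e2, e3, e4]
  simp only [div_eq_mul_inv]
  refine ⟨?_, ?_, ?_, ?_⟩
  · exact contDiff_conj'.contDiffOn.mul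
      ((contDiff_rrC.pow 2).inv fun p hp => pow_ne_zero _ (hne p hp))
  · exact contDiff_t'.contDiffOn.mul (contDiff_rrC.inv hne)
  · exact contDiff_t'.contDiffOn.mul
      ((contDiff_rrC.pow 3).inv fun p hp => pow_ne_zero _ (hne p hp))
  · exact (contDiff_const.mul contDiff_conj').contDiffOn.mul
      ((contDiff_rrC.pow 3).inv fun p hp => pow_ne_zero _ (hne p hp))

/-- Normal form modulo the ideal. -/
lemma normal_form (f : MvPolynomial (Fin 3) ℂ) :
    ∃ a b : MvPolynomial (Fin 2) ℂ,
      f - (rename Fin.castSucc a + rename Fin.castSucc b * X 2) ∈ RavPolyIdeal := by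
  induction f using MvPolynomial.induction_on with
  | C c => exact ⟨C c, 0, by simp⟩
  | add p q hp hq =>
    obtain ⟨a, b, h⟩ := hp
    obtain ⟨a', b', h'⟩ := hq
    refine ⟨a + a', b + b', ?_⟩
    have := add_mem h h'
    convert this using 1
    simp only [map_add]; ring
  | mul_X p i hp =>
    obtain ⟨a, b, h⟩ := hp
    have hg : (X 0 * X 1 + X 2 ^ 2 - 1 : MvPolynomial (Fin 3) ℂ) ∈ RavPolyIdeal :=
      Ideal.subset_span rfl
    fin_cases i
    · refine ⟨a * X 0, b * X 0, ?_⟩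
      convert Ideal.mul_mem_right (X 0) _ h using 1
      simp; ring
    · refine ⟨a * X 1, b * X 1, ?_⟩
      convert Ideal.mul_mem_right (X 1) _ h using 1
      simp; ring
    · refine ⟨b * (1 - X 0 * X 1), a, ?_⟩
      convert add_mem (Ideal.mul_mem_right (X 2) _ h)
        (Ideal.mul_mem_left _ (rename Fin.castSucc b) hg) using 1
      simp; ring

/-- The evaluation map on polynomials. -/
def jpoly : MvPolynomial (Fin 3) ℂ →ₐ[ℂ] ({p : ℂ × ℝ // p ≠ (0, 0)} → ℂ) :=
  aeval ![fun q => q.1.1, fun q => jlam q.1, fun q => jx q.1]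

lemma jpoly_ideal (f : MvPolynomial (Fin 3) ℂ) (hf : f ∈ RavPolyIdeal) : jpoly f = 0 := by
  have : RavPolyIdeal ≤ RingHom.ker jpoly := by
    rw [RavPolyIdeal, Ideal.span_le, Set.singleton_subset_iff]
    change jpoly _ = 0
    funext q
    have := part_a q.1 q.2
    simp [jpoly, this]
  exact this hf

lemma jpoly_rename (a : MvPolynomial (Fin 2) ℂ) (q : {p : ℂ × ℝ // p ≠ (0, 0)}) :
    jpoly (rename Fin.castSucc a) q = eval ![q.1.1, jlam q.1] a := by
  induction a using MvPolynomial.induction_on with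
  | C c => simp [jpoly]
  | add p q hp hq => simp [hp, hq]
  | mul_X p i hp =>
    simp only [map_mul, Pi.mul_apply, hp, rename_X, eval_X]
    congr 1
    fin_cases i <;> simp [jpoly]

lemma point_eval (u w : ℝ) (hu : u ∈ Set.Ioo (0 : ℝ) 1) (hw : w ∈ Set.Ioo (0 : ℝ) 1) (t : ℝ)
    (ht : t ^ 2 = u / w - u ^ 2) : jlam ((u : ℂ), t) = w := by
  rw [jlam]
  have h : normSq (u : ℂ) + t ^ 2 = u / w := by rw [normSq_ofReal, ht]; ring
  have hu' : (u : ℂ) ≠ 0 := by exact_mod_cast hu.1.ne'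
  have hw' : (w : ℂ) ≠ 0 := by exact_mod_cast hw.1.ne'
  simp only [h, conj_ofReal]
  push_cast
  field_simp

lemma jpoly_inj (f : MvPolynomial (Fin 3) ℂ) (hf : jpoly f = 0) : f ∈ RavPolyIdeal := by
  obtain ⟨a, b, hab⟩ := normal_form f
  have key : ∀ u ∈ Set.Ioo (0 : ℝ) 1, ∀ w ∈ Set.Ioo (0 : ℝ) 1,
      eval ![(u : ℂ), (w : ℂ)] a = 0 ∧ eval ![(u : ℂ), (w : ℂ)] b = 0 := by
    intro u hu w hw
    have hpos : 0 < u / w - u ^ 2 := by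
      have h1 : u / w - u ^ 2 = u * (1 - u * w) / w := by
        have := hw.1.ne'
        field_simp
      rw [h1]
      have : u * w < 1 := by nlinarith [hu.1, hu.2, hw.1, hw.2]
      have h3 := hu.1
      have h4 := hw.1
      have : 0 < 1 - u * w := by linarith
      positivity
    obtain ⟨t, ht0, ht⟩ : ∃ t : ℝ, 0 < t ∧ t ^ 2 = u / w - u ^ 2 :=
      ⟨_, Real.sqrt_pos.2 hpos, Real.sq_sqrt hpos.le⟩
    have ev : ∀ s : ℝ, s ^ 2 = u / w - u ^ 2 →
        eval ![(u : ℂ), (w : ℂ)] a + eval ![(u : ℂ), (w : ℂ)] b * jx ((u : ℂ), s) = 0 := by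
      intro s hs
      have hne : ((u : ℂ), s) ≠ ((0 : ℂ), (0 : ℝ)) := by
        intro h
        have : (u : ℂ) = 0 := congrArg Prod.fst h
        exact hu.1.ne' (by exact_mod_cast this)
      have h0 := congrFun (jpoly_ideal _ hab) ⟨_, hne⟩
      rw [map_sub, hf, map_add, map_mul] at h0
      simp only [Pi.sub_apply, Pi.add_apply, Pi.mul_apply, jpoly_rename,
        point_eval u w hu hw s hs] at h0
      have hX : jpoly (X 2) ⟨((u : ℂ), s), hne⟩ = jx ((u : ℂ), s) := by simp [jpoly]
      rw [hX] at h0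
      rw [Pi.zero_apply] at h0
      linear_combination -h0
    have e1 := ev t ht
    have e2 := ev (-t) (by rw [neg_sq, ht])
    have hneg : jx ((u : ℂ), -t) = - jx ((u : ℂ), t) := by simp [jx, neg_div]
    have hne : jx ((u : ℂ), t) ≠ 0 := by
      rw [jx]
      have : 0 < normSq (u : ℂ) + t ^ 2 := by
        have := normSq_nonneg (u : ℂ)
        positivity
      exact_mod_cast (div_pos ht0 (Real.sqrt_pos.2 this)).ne'
    rw [hneg] at e2
    have ea : eval ![(u : ℂ), (w : ℂ)] a = 0 := by linear_combination (e1 + e2) / 2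
    refine ⟨ea, ?_⟩
    rw [ea, zero_add] at e1
    exact (mul_eq_zero.1 e1).resolve_right hne
  have hinf : ∀ _ : Fin 2, (((↑) : ℝ → ℂ) '' Set.Ioo (0 : ℝ) 1).Infinite := fun _ =>
    (Set.Ioo_infinite one_pos).image ofReal_injective.injOn
  have ext : ∀ x ∈ Set.pi .univ (fun _ : Fin 2 => ((↑) : ℝ → ℂ) '' Set.Ioo (0 : ℝ) 1),
      eval x a = 0 ∧ eval x b = 0 := by
    intro x hx
    obtain ⟨u, hu, hu'⟩ := hx 0 trivial
    obtain ⟨w, hw, hw'⟩ := hx 1 trivial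
    have : x = ![(u : ℂ), (w : ℂ)] := by
      funext i
      fin_cases i
      · exact hu'.symm
      · exact hw'.symm
    rw [this]
    exact key u hu w hw
  have ha : a = 0 := funext_set _ hinf fun x hx => by rw [(ext x hx).1, map_zero]
  have hb : b = 0 := funext_set _ hinf fun x hx => by rw [(ext x hx).2, map_zero]
  simpa [ha, hb] using hab

lemma part_b : ∃ j : RavR →ₐ[ℂ] ({p : ℂ × ℝ // p ≠ (0, 0)} → ℂ),
      (j (Ideal.Quotient.mk RavPolyIdeal (X 0)) = fun q => q.1.1) ∧
      (j (Ideal.Quotient.mk RavPolyIdeal (X 1)) = fun q => jlam q.1) ∧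
      (j (Ideal.Quotient.mk RavPolyIdeal (X 2)) = fun q => jx q.1) ∧
      Function.Injective j := by
  refine ⟨Ideal.Quotient.liftₐ RavPolyIdeal jpoly jpoly_ideal, ?_, ?_, ?_, ?_⟩
  · change jpoly (X 0) = _
    simp [jpoly]
  · change jpoly (X 1) = _
    simp [jpoly]
  · change jpoly (X 2) = _
    simp [jpoly]
  · rw [injective_iff_map_eq_zero]
    intro a ha
    obtain ⟨f, rfl⟩ := Ideal.Quotient.mk_surjective a
    exact Ideal.Quotient.eq_zero_iff_mem.2 (jpoly_inj f ha)

lemma rr_eq (x y t : ℝ) : rr ((x : ℂ) + (y : ℂ) * I, t) = Real.sqrt (x ^ 2 + y ^ 2 + t ^ 2) := by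
  rw [rr, normSq_add_mul_I]

lemma sqrt_deriv (c x : ℝ) (h : 0 < x ^ 2 + c) :
    HasDerivAt (fun s : ℝ => Real.sqrt (s ^ 2 + c)) (x / Real.sqrt (x ^ 2 + c)) x := by
  have h1 : HasDerivAt (fun s : ℝ => s ^ 2 + c) (2 * x) x := by
    simpa using ((hasDerivAt_id x).pow 2).add_const c
  convert h1.sqrt h.ne' using 1
  have := (Real.sqrt_pos.2 h).ne'
  field_simp

section derivs

variable (z : ℂ) (t : ℝ) (h : (z, t) ≠ ((0 : ℂ), (0 : ℝ)))

lemma rr_self : rr (z, t) = Real.sqrt (z.re ^ 2 + z.im ^ 2 + t ^ 2) := by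
  rw [← rr_eq, re_add_im]

lemma arg_pos (h : (z, t) ≠ ((0 : ℂ), (0 : ℝ))) : 0 < z.re ^ 2 + z.im ^ 2 + t ^ 2 := by
  have := rr_pos _ h
  rw [rr_self] at this
  exact Real.sqrt_pos.1 this

lemma rr_dx (h : (z, t) ≠ ((0 : ℂ), (0 : ℝ))) :
    HasDerivAt (fun x : ℝ => (rr ((x : ℂ) + (z.im : ℂ) * I, t) : ℂ))
      ((z.re : ℂ) / (rr (z, t) : ℂ)) z.re := by
  have h0 := arg_pos z t h
  have h1 := (sqrt_deriv (z.im ^ 2 + t ^ 2) z.re (by linarith)).ofReal_comp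
  rw [rr_self]
  simp only [rr_eq]
  simpa only [ofReal_div, add_assoc] using h1

lemma rr_dy (h : (z, t) ≠ ((0 : ℂ), (0 : ℝ))) :
    HasDerivAt (fun y : ℝ => (rr ((z.re : ℂ) + (y : ℂ) * I, t) : ℂ))
      ((z.im : ℂ) / (rr (z, t) : ℂ)) z.im := by
  have h0 := arg_pos z t h
  have h1 := (sqrt_deriv (z.re ^ 2 + t ^ 2) z.im (by linarith)).ofReal_comp
  rw [rr_self]
  simp only [rr_eq]
  simpa only [ofReal_div, add_left_comm, add_assoc] using h1

lemma rr_dt (h : (z, t) ≠ ((0 : ℂ), (0 : ℝ))) :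
    HasDerivAt (fun s : ℝ => (rr (z, s) : ℂ)) ((t : ℂ) / (rr (z, t) : ℂ)) t := by
  have h0 := arg_pos z t h
  have h1 := (sqrt_deriv (z.re ^ 2 + z.im ^ 2) t (by linarith)).ofReal_comp
  simp only [rr_self]
  simpa only [ofReal_div, add_comm (t ^ 2), add_comm (_ ^ 2) (z.re ^ 2 + z.im ^ 2)] using h1

end derivs

lemma conj_dx (z : ℂ) : HasDerivAt (fun x : ℝ => starRingEnd ℂ ((x : ℂ) + (z.im : ℂ) * I))
    1 z.re := by
  simp only [map_add, conj_ofReal]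
  exact (hasDerivAt_id z.re).ofReal_comp.add_const _

lemma conj_dy (z : ℂ) : HasDerivAt (fun y : ℝ => starRingEnd ℂ ((z.re : ℂ) + (y : ℂ) * I))
    (-I) z.im := by
  simp only [map_add, map_mul, conj_ofReal, conj_I]
  simpa using ((hasDerivAt_id z.im).ofReal_comp.mul_const (-I)).const_add (z.re : ℂ)

lemma wirtinger_of {g : ℂ → ℂ} {u a b : ℂ}
    (ha : HasDerivAt (fun x : ℝ => g ((x : ℂ) + (u.im : ℂ) * I)) a u.re)
    (hb : HasDerivAt (fun y : ℝ => g ((u.re : ℂ) + (y : ℂ) * I)) b u.im) :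
    wirtingerBar g u = (1 / 2) * (a + I * b) := by
  rw [wirtingerBar, ha.deriv, hb.deriv]

lemma conj_eq' (z : ℂ) : starRingEnd ℂ z = z.re - z.im * I := by
  apply Complex.ext <;> simp

lemma quot_deriv {f g : ℝ → ℂ} {f' g' c r : ℂ} {x : ℝ} (n : ℕ) (hf : HasDerivAt f f' x)
    (hg : HasDerivAt g g' x) (hc : f x = c) (hgr : g x = r) (hr : r ≠ 0) :
    HasDerivAt (fun s => f s / g s ^ (n + 1))
      (f' / r ^ (n + 1) - (n + 1) * c * g' / r ^ (n + 2)) x := by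
  subst hc hgr
  have h1 : HasDerivAt (fun s => f s / g s ^ (n + 1)) _ x :=
    hf.div (hg.pow (n + 1)) (pow_ne_zero _ hr)
  convert h1 using 1
  simp only [Nat.add_sub_cancel]
  push_cast
  field_simp
  ring

lemma part_c (z : ℂ) (t : ℝ) (h : (z, t) ≠ ((0 : ℂ), (0 : ℝ))) :
      (wirtingerBar (fun z' => jlam (z', t)) z = jx (z, t) * omZbar (z, t)) ∧
      (deriv (fun t' : ℝ => jlam (z, t')) t = jx (z, t) * omT (z, t)) ∧
      (wirtingerBar (fun z' => jx (z', t)) z = -(1 / 2) * z * omZbar (z, t)) ∧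
      (deriv (fun t' : ℝ => jx (z, t')) t = -(1 / 2) * z * omT (z, t)) ∧
      (wirtingerBar (fun z' => omT (z', t)) z = deriv (fun t' : ℝ => omZbar (z, t')) t) := by
  have hx := rr_dx z t h
  have hy := rr_dy z t h
  have ht := rr_dt z t h
  have hr : (rr (z, t) : ℂ) ≠ 0 := by exact_mod_cast (rr_pos _ h).ne'
  have hsq := rr_sq_C z t
  have hz : z = z.re + z.im * I := (re_add_im z).symm
  have hc := conj_eq' z
  have hI : I ^ 2 = -1 := I_sq
  have ez : (z.re : ℂ) + (z.im : ℂ) * I = z := re_add_im z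
  have hid : HasDerivAt (fun s : ℝ => (s : ℂ)) 1 t := (hasDerivAt_id t).ofReal_comp
  simp only [jlam_eq, jx_eq, omZbar_eq, omT_eq]
  have r2 := pow_ne_zero 2 hr
  have r3 := pow_ne_zero 3 hr
  have ecx : starRingEnd ℂ ((z.re : ℂ) + (z.im : ℂ) * I) = z.re - z.im * I := by rw [ez, hc]
  have erx : (rr ((z.re : ℂ) + (z.im : ℂ) * I, t) : ℂ) = rr (z, t) := by rw [ez]
  have d1 := wirtinger_of (g := fun z' => starRingEnd ℂ z' / (rr (z', t) : ℂ) ^ 2)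
    (quot_deriv 1 (conj_dx z) hx ecx erx hr) (quot_deriv 1 (conj_dy z) hy ecx erx hr)
  have d2 := (quot_deriv 1 (hasDerivAt_const t (starRingEnd ℂ z)) ht hc rfl hr).deriv
  have d3 := wirtinger_of (g := fun z' => (t : ℂ) / (rr (z', t) : ℂ) ^ 1)
    (quot_deriv 0 (hasDerivAt_const z.re (t : ℂ)) hx rfl erx hr)
    (quot_deriv 0 (hasDerivAt_const z.im (t : ℂ)) hy rfl erx hr)
  have d4 := (quot_deriv 0 hid ht rfl rfl hr).deriv
  have d5 := wirtinger_of (g := fun z' => -2 * starRingEnd ℂ z' / (rr (z', t) : ℂ) ^ 3)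
    (quot_deriv 2 ((conj_dx z).const_mul (-2)) hx (congrArg (-2 * ·) ecx) erx hr)
    (quot_deriv 2 ((conj_dy z).const_mul (-2)) hy (congrArg (-2 * ·) ecx) erx hr)
  have d6 := (quot_deriv 2 hid ht rfl rfl hr).deriv
  simp only [zero_add, pow_one] at d3 d4
  norm_num only [] at d1 d2 d5 d6
  rw [d1, d2, d3, d4, d5, d6, hc]
  clear d1 d2 d3 d4 d5 d6 hx hy ht ecx erx hid r2 r3 ez hc h
  generalize (rr (z, t) : ℂ) = r at *
  generalize (z.re : ℂ) = x at *
  generalize (z.im : ℂ) = y at *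
  generalize (t : ℂ) = t at *
  subst hz
  generalize I = i at *
  push_cast
  refine ⟨?_, ?_, ?_, ?_, ?_⟩ <;> field_simp <;> grind

/-- The algebraic model embeds into the Dolbeault–de Rham complex of the punctured space
(Proposition 1.6): on `X = (ℂ × ℝ) ∖ {0}`, (a) `z·jλ + (jx)² = 1`, so the assignment
`z ↦ z`, `λ ↦ z̄/r²`, `x ↦ t/r` extends to an algebra homomorphism
`j : R → C^∞(X, ℂ)` (the generating functions are smooth on `X`); (b) `j` is injective;
(c) `j` is a cochain map, and the form `ω(z̲;0)` is `d′`-closed. -/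
theorem raviolo_model_embedding :
    (∀ p : ℂ × ℝ, p ≠ (0, 0) → p.1 * jlam p + (jx p) ^ 2 = 1) ∧
    (ContDiffOn ℝ (⊤ : ℕ∞) jlam {p : ℂ × ℝ | p ≠ (0, 0)} ∧
      ContDiffOn ℝ (⊤ : ℕ∞) jx {p : ℂ × ℝ | p ≠ (0, 0)} ∧
      ContDiffOn ℝ (⊤ : ℕ∞) omZbar {p : ℂ × ℝ | p ≠ (0, 0)} ∧
      ContDiffOn ℝ (⊤ : ℕ∞) omT {p : ℂ × ℝ | p ≠ (0, 0)}) ∧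
    (∃ j : RavR →ₐ[ℂ] ({p : ℂ × ℝ // p ≠ (0, 0)} → ℂ),
      (j (Ideal.Quotient.mk RavPolyIdeal (X 0)) = fun q => q.1.1) ∧
      (j (Ideal.Quotient.mk RavPolyIdeal (X 1)) = fun q => jlam q.1) ∧
      (j (Ideal.Quotient.mk RavPolyIdeal (X 2)) = fun q => jx q.1) ∧
      Function.Injective j) ∧
    (∀ (z : ℂ) (t : ℝ), (z, t) ≠ ((0 : ℂ), (0 : ℝ)) →
      (wirtingerBar (fun z' => jlam (z', t)) z = jx (z, t) * omZbar (z, t)) ∧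
      (deriv (fun t' : ℝ => jlam (z, t')) t = jx (z, t) * omT (z, t)) ∧
      (wirtingerBar (fun z' => jx (z', t)) z = -(1 / 2) * z * omZbar (z, t)) ∧
      (deriv (fun t' : ℝ => jx (z, t')) t = -(1 / 2) * z * omT (z, t)) ∧
      (wirtingerBar (fun z' => omT (z', t)) z = deriv (fun t' : ℝ => omZbar (z, t')) t)) := by
  exact ⟨part_a, part_smooth, part_b, part_c⟩
end
end

section
/- Uniqueness lemma for bivariate raviolo distributions (Lemma 1.9): Let N ≥ 0 be an integer and let f ∈ 𝒦^{z,w}_dist satisfy (1) (z−w)^{N+1} f = 0, and (2) for every m ≥ 0, (Ω^m_z − Σ_{j=0}^N (−1)^j C(m+j, j) (z−w)^j Ω^{m+j}_w) · f = 0. Then f can be written uniquely as f = Σ_{i=0}^N ∂^i_w Δ(z−w) · g^{(i)}(w) where each g^{(i)} is a formal raviolo distribution in the variable w. Conversely, every f of this form satisfies conditions (1) and (2). -/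
noncomputable section

/-- Univariate formal raviolo distributions: the coefficient at index `m < 0` is that of
`w^{−m−1}`, and the coefficient at index `m ≥ 0` is that of `Ω^m_w`. -/
abbrev KDist := ℤ → ℂ

/-- Bivariate formal raviolo distributions `𝒦^{z,w}_dist`, encoded by their coefficients on
the basis monomials (z-part)·(w-part). -/
abbrev KDist2 := ℤ → ℤ → ℂ

/-- Validity of combining monomial indices `a`, `b` in one variable. -/
def okIdx (a b : ℤ) : Prop := (a < 0 ∧ b < 0) ∨ (¬(0 ≤ a ∧ 0 ≤ b) ∧ 0 ≤ a + b + 1)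

instance (a b : ℤ) : Decidable (okIdx a b) := by unfold okIdx; infer_instance

def sgnZ (m : ℤ) : ℂ := if 0 ≤ m then 1 else -1

/-- The generalized binomial coefficient `C(m,n) = m(m−1)⋯(m−n+1)/n!`. -/
def genBinom (m : ℤ) (n : ℕ) : ℂ :=
  (∏ i ∈ Finset.range n, ((m : ℂ) - (i : ℂ))) / (n.factorial : ℂ)

/-- Multiplication by `z`. -/
def mulZ2 (f : KDist2) : KDist2 := fun m k => if m = -1 then 0 else f (m + 1) k

/-- Multiplication by `w`. -/
def mulW2 (f : KDist2) : KDist2 := fun m k => if k = -1 then 0 else f m (k + 1)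

/-- Multiplication by `(z − w)`. -/
def zmw (f : KDist2) : KDist2 := fun m k => mulZ2 f m k - mulW2 f m k

/-- Left multiplication by `Ω^j_z`. -/
def mulOmegaZ (j : ℕ) (f : KDist2) : KDist2 := fun m k =>
  if 0 ≤ m ∧ m ≤ (j : ℤ) then f (m - (j : ℤ) - 1) k else 0

/-- Left multiplication by `Ω^j_w` (with the Koszul sign from moving `Ω^j_w` past the
`z`-part of the monomial). -/
def mulOmegaW (j : ℕ) (f : KDist2) : KDist2 := fun m k =>
  if 0 ≤ k ∧ k ≤ (j : ℤ) then (if 0 ≤ m then (-1 : ℂ) else 1) * f m (k - (j : ℤ) - 1) else 0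

/-- The product `∂^i_w Δ(z−w) · g(w)` of the `i`-th `w`-derivative of the raviolo delta
function with a formal raviolo distribution `g` in `w`. -/
def deltaDerivMulW (i : ℕ) (g : KDist) : KDist2 := fun m k =>
  if okIdx ((i : ℤ) - m - 1) (k - (i : ℤ) + m) then
    ((i.factorial : ℂ) * sgnZ m * genBinom m i) * g (k - (i : ℤ) + m)
  else 0

/-! ### Helper material -/

lemma genBinom_eq (m : ℤ) (n : ℕ) : genBinom m n = ((Ring.choose m n : ℤ) : ℂ) := by
  have h := Ring.descPochhammer_eq_factorial_smul_choose m n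
  have h2 : (∏ i ∈ Finset.range n, ((m : ℂ) - (i : ℂ)))
      = (n.factorial : ℂ) * ((Ring.choose m n : ℤ) : ℂ) := by
    have h3 : (Polynomial.smeval (descPochhammer ℤ n) m) = ∏ i ∈ Finset.range n, (m - (i : ℤ)) := by
      rw [← Polynomial.aeval_eq_smeval, Polynomial.coe_aeval_eq_eval]
      rw [descPochhammer_eval_eq_prod_range]
    rw [h3] at h
    have h4 := congrArg (fun x : ℤ => (x : ℂ)) h
    simpa using h4
  unfold genBinom
  rw [h2, mul_div_cancel_left₀]
  exact_mod_cast n.factorial_ne_zero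

lemma genBinom_pascal (m : ℤ) (n : ℕ) :
    genBinom (m + 1) (n + 1) = genBinom m n + genBinom m (n + 1) := by
  simp only [genBinom_eq]
  rw [Ring.choose_succ_succ]
  push_cast
  ring

lemma genBinom_zero (m : ℤ) : genBinom m 0 = 1 := by simp [genBinom]

lemma genBinom_vanish (m : ℤ) (n : ℕ) (h0 : 0 ≤ m) (h : m < n) : genBinom m n = 0 := by
  unfold genBinom
  rw [Finset.prod_eq_zero (i := m.toNat), zero_div]
  · simp; omega
  · have : ((m.toNat : ℤ) : ℂ) = (m : ℂ) := by rw [Int.toNat_of_nonneg h0]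
    rw [← this, Int.cast_natCast, sub_self]

lemma genBinom_neg (m j : ℕ) :
    genBinom (-(m : ℤ) - 1) j = (-1 : ℂ) ^ j * (Nat.choose (m + j) j : ℂ) := by
  rw [genBinom_eq]
  have : (-(m : ℤ) - 1) = -((m : ℤ) + 1) := by ring
  rw [this, Ring.choose_neg]
  have h2 : ((m : ℤ) + 1 + j - 1) = ((m + j : ℕ) : ℤ) := by push_cast; ring
  rw [h2, Ring.choose_natCast]
  simp [Int.negOnePow_def, Units.smul_def]

lemma genBinom_vandermonde (x : ℤ) (m i : ℕ) :
    genBinom (x - m - 1) i = ∑ j ∈ Finset.range (i + 1),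
      ((-1 : ℂ) ^ j * (Nat.choose (m + j) j : ℂ)) * genBinom x (i - j) := by
  have h := Ring.add_choose_eq (r := -(m : ℤ) - 1) (s := x) i (Commute.all _ _)
  rw [Finset.Nat.sum_antidiagonal_eq_sum_range_succ_mk] at h
  have e : x - m - 1 = -(m : ℤ) - 1 + x := by ring
  rw [e, genBinom_eq, h]
  push_cast
  refine Finset.sum_congr rfl fun j _ => ?_
  rw [← genBinom_neg, genBinom_eq, genBinom_eq]

/-- Normalised delta derivative times `g`. -/
def EL (i : ℕ) : KDist →ₗ[ℂ] KDist2 where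
  toFun g := fun m k => if okIdx ((i : ℤ) - m - 1) (k - (i : ℤ) + m) then
    (sgnZ m * genBinom m i) * g (k - (i : ℤ) + m) else 0
  map_add' x y := by
    ext m k
    simp only [Pi.add_apply]
    split_ifs <;> ring
  map_smul' c x := by
    ext m k
    simp only [Pi.smul_apply, smul_eq_mul, RingHom.id_apply]
    split_ifs <;> ring

lemma EL_apply (i : ℕ) (g : KDist) (m k : ℤ) :
    EL i g m k = if okIdx ((i : ℤ) - m - 1) (k - (i : ℤ) + m) then
    (sgnZ m * genBinom m i) * g (k - (i : ℤ) + m) else 0 := rfl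

lemma delta_eq (i : ℕ) (g : KDist) : deltaDerivMulW i g = EL i ((i.factorial : ℂ) • g) := by
  ext m k
  rw [EL_apply]
  simp only [deltaDerivMulW, Pi.smul_apply, smul_eq_mul]
  split_ifs <;> ring

/-- `zmw` as a linear map. -/
def ZL : KDist2 →ₗ[ℂ] KDist2 where
  toFun := zmw
  map_add' x y := by
    ext m k
    simp only [zmw, mulZ2, mulW2, Pi.add_apply]
    split_ifs <;> ring
  map_smul' c x := by
    ext m k
    simp only [zmw, mulZ2, mulW2, Pi.smul_apply, smul_eq_mul, RingHom.id_apply]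
    split_ifs <;> ring

lemma ZL_apply (f : KDist2) (m k : ℤ) :
    ZL f m k = (if m = -1 then 0 else f (m + 1) k) - (if k = -1 then 0 else f m (k + 1)) := rfl

lemma zmw_iter (n : ℕ) (f : KDist2) : zmw^[n] f = (ZL ^ n) f := by
  rw [Module.End.pow_apply]; rfl

/-- `mulOmegaW` as a linear map. -/
def WL (j : ℕ) : KDist2 →ₗ[ℂ] KDist2 where
  toFun := mulOmegaW j
  map_add' x y := by
    ext m k
    simp only [mulOmegaW, Pi.add_apply]
    split_ifs <;> ring
  map_smul' c x := by
    ext m k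
    simp only [mulOmegaW, Pi.smul_apply, smul_eq_mul, RingHom.id_apply]
    split_ifs <;> ring

lemma WL_apply (j : ℕ) (f : KDist2) (m k : ℤ) : WL j f m k =
  if 0 ≤ k ∧ k ≤ (j : ℤ) then (if 0 ≤ m then (-1 : ℂ) else 1) * f m (k - (j : ℤ) - 1) else 0 := rfl

/-- `mulOmegaZ` as a linear map. -/
def OL (j : ℕ) : KDist2 →ₗ[ℂ] KDist2 where
  toFun := mulOmegaZ j
  map_add' x y := by
    ext m k
    simp only [mulOmegaZ, Pi.add_apply]
    split_ifs <;> ring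
  map_smul' c x := by
    ext m k
    simp only [mulOmegaZ, Pi.smul_apply, smul_eq_mul, RingHom.id_apply]
    split_ifs <;> ring

lemma OL_apply (j : ℕ) (f : KDist2) (m k : ℤ) : OL j f m k =
  if 0 ≤ m ∧ m ≤ (j : ℤ) then f (m - (j : ℤ) - 1) k else 0 := rfl

lemma ZL_WL (j : ℕ) (f : KDist2) : ZL (WL j f) = WL j (ZL f) := by
  ext m k
  simp only [ZL_apply, WL_apply]
  have e : k + 1 - (j : ℤ) - 1 = k - j - 1 + 1 := by ring
  rw [e]
  by_cases hm : m = -1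
  · have h1 : ¬ 0 ≤ m := by omega
    simp only [if_pos hm, if_neg h1]
    split_ifs <;> first | ring1 | (exfalso; omega)
  · have h1 : (0 ≤ m + 1) ↔ 0 ≤ m := by omega
    simp only [if_neg hm, h1]
    split_ifs <;> first | ring1 | (exfalso; omega)

lemma ZLpow_WL (n j : ℕ) (f : KDist2) : (ZL ^ n) (WL j f) = WL j ((ZL ^ n) f) := by
  induction n with
  | zero => simp
  | succ n ih => rw [pow_succ', Module.End.mul_apply, ih, ZL_WL, Module.End.mul_apply]

lemma ZL_EL_zero (g : KDist) : ZL (EL 0 g) = 0 := by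
  ext m k
  simp only [ZL_apply, EL_apply, genBinom_zero, sgnZ, Pi.zero_apply]
  have e : k + 1 - ((0 : ℕ) : ℤ) + m = k - ((0 : ℕ) : ℤ) + (m + 1) := by ring
  rw [e]
  split_ifs <;> first | ring1 | (exfalso; (try simp only [okIdx] at *) <;> omega)

lemma ZL_EL_succ (i : ℕ) (g : KDist) : ZL (EL (i + 1) g) = EL i g := by
  ext m k
  simp only [ZL_apply, EL_apply, genBinom_pascal]
  have e : k + 1 - ((i + 1 : ℕ) : ℤ) + m = k - i + m := by push_cast; ring
  have e' : k - ((i + 1 : ℕ) : ℤ) + (m + 1) = k - i + m := by push_cast; ring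
  rw [e, e']
  have e1 : ((i + 1 : ℕ) : ℤ) - (m + 1) - 1 = i - m - 1 := by push_cast; ring
  have e2 : ((i + 1 : ℕ) : ℤ) - m - 1 = i - m := by push_cast; ring
  rw [e1, e2]
  by_cases h1 : 0 ≤ m ∧ m < i
  · rw [genBinom_vanish m i h1.1 h1.2, genBinom_vanish m (i + 1) h1.1 (by push_cast; omega)]
    simp
  by_cases h2 : m = i
  · subst h2
    rw [genBinom_vanish (i : ℤ) (i + 1) (by omega) (by push_cast; omega)]
    simp only [sgnZ]
    split_ifs <;> first | ring1 | (exfalso; (try simp only [okIdx] at *) <;> omega)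
  by_cases h3 : m = -1
  · subst h3
    have hp := genBinom_pascal (-1) i
    rw [show (-1 : ℤ) + 1 = 0 by ring, genBinom_vanish 0 (i + 1) le_rfl (by push_cast; omega)] at hp
    have hq : genBinom (-1) (i + 1) = - genBinom (-1) i := by linear_combination -hp
    rw [hq]
    simp only [sgnZ]
    split_ifs <;> first | ring1 | (exfalso; (try simp only [okIdx] at *) <;> omega)
  · simp only [sgnZ]
    split_ifs <;> first | ring1 | (exfalso; (try simp only [okIdx] at *) <;> omega)

lemma ZLpow_EL (j i : ℕ) (g : KDist) :
    (ZL ^ j) (EL i g) = if j ≤ i then EL (i - j) g else 0 := by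
  induction j with
  | zero => simp
  | succ j ih =>
    rw [pow_succ', Module.End.mul_apply, ih]
    by_cases h : j + 1 ≤ i
    · rw [if_pos h, if_pos (by omega)]
      obtain ⟨t, rfl⟩ : ∃ t, i = t + 1 + j := ⟨i - j - 1, by omega⟩
      rw [show t + 1 + j - j = t + 1 by omega, ZL_EL_succ, show t + 1 + j - (j + 1) = t by omega]
    · rw [if_neg h]
      split_ifs with h'
      · rw [show i - j = 0 by omega, ZL_EL_zero]
      · simp

lemma omega_EL (m i : ℕ) (g : KDist) :
    OL m (EL i g) = ∑ j ∈ Finset.range (i + 1),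
      ((-1 : ℂ) ^ j * (Nat.choose (m + j) j : ℂ)) • WL (m + j) (EL (i - j) g) := by
  ext m' k
  simp only [Finset.sum_apply, Pi.smul_apply, smul_eq_mul]
  have key : ∀ j ∈ Finset.range (i + 1), WL (m + j) (EL (i - j) g) m' k =
      if 0 ≤ m' ∧ 0 ≤ k ∧ k - m - 1 - i + m' < 0 then
        - (genBinom m' (i - j) * g (k - m - 1 - i + m')) else 0 := by
    intro j hj
    have hj' : j ≤ i := by simpa [Nat.lt_succ_iff] using hj
    rw [WL_apply, EL_apply]
    have e : k - ((m + j : ℕ) : ℤ) - 1 - ((i - j : ℕ) : ℤ) + m' = k - m - 1 - i + m' := by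
      push_cast [hj']; ring
    rw [e]
    by_cases h1 : 0 ≤ m' ∧ m' < ((i - j : ℕ) : ℤ)
    · rw [genBinom_vanish m' (i - j) h1.1 h1.2]; simp
    · simp only [sgnZ]
      split_ifs <;> first | ring1 | (exfalso; (try simp only [okIdx] at *) <;> omega)
  rw [Finset.sum_congr rfl fun j hj => by rw [key j hj]]
  have hV := genBinom_vandermonde m' m i
  have hR : (∑ j ∈ Finset.range (i + 1), ((-1 : ℂ) ^ j * (Nat.choose (m + j) j : ℂ)) *
      (if 0 ≤ m' ∧ 0 ≤ k ∧ k - m - 1 - i + m' < 0 then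
        - (genBinom m' (i - j) * g (k - m - 1 - i + m')) else 0)) =
      if 0 ≤ m' ∧ 0 ≤ k ∧ k - m - 1 - i + m' < 0 then
        - (genBinom (m' - m - 1) i * g (k - m - 1 - i + m')) else 0 := by
    split_ifs
    · rw [hV, Finset.sum_mul, ← Finset.sum_neg_distrib]
      exact Finset.sum_congr rfl fun j _ => by ring
    · simp
  rw [hR, OL_apply, EL_apply]
  have e : k - (i : ℤ) + (m' - m - 1) = k - m - 1 - i + m' := by ring
  rw [e]
  by_cases h1 : 0 ≤ m' - m - 1 ∧ m' - m - 1 < i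
  · rw [genBinom_vanish _ i h1.1 h1.2]; simp
  · simp only [sgnZ]
    split_ifs <;> first | ring1 | (exfalso; (try simp only [okIdx] at *) <;> omega)

lemma conv_one (N : ℕ) (g : ℕ → KDist) :
    (ZL ^ N) (∑ i ∈ Finset.range N, EL i (g i)) = 0 := by
  rw [map_sum]
  refine Finset.sum_eq_zero fun i hi => ?_
  rw [ZLpow_EL, if_neg]
  simpa using hi

lemma conv_two (N m : ℕ) (g : ℕ → KDist) :
    OL m (∑ i ∈ Finset.range (N + 1), EL i (g i)) =
      ∑ j ∈ Finset.range (N + 1), ((-1 : ℂ) ^ j * (Nat.choose (m + j) j : ℂ)) •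
        (ZL ^ j) (WL (m + j) (∑ i ∈ Finset.range (N + 1), EL i (g i))) := by
  simp only [map_sum, Finset.smul_sum]
  rw [Finset.sum_comm]
  refine Finset.sum_congr rfl fun i hi => ?_
  have hi' : i ≤ N := by simpa [Nat.lt_succ_iff] using hi
  rw [omega_EL]
  rw [← Finset.sum_subset (Finset.range_subset_range.2 (show i + 1 ≤ N + 1 by omega))]
  · refine Finset.sum_congr rfl fun j hj => ?_
    rw [ZLpow_WL, ZLpow_EL, if_pos (by simpa [Nat.lt_succ_iff] using hj)]
  · intro j _ hj
    rw [ZLpow_WL, ZLpow_EL, if_neg (by simpa [Nat.lt_succ_iff] using hj)]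
    simp

lemma base_exists (f : KDist2) (h : ∀ m k : ℤ, (0 ≤ m ∨ k < 0) → ZL f m k = 0) :
    ∃ g : KDist, ∀ m k : ℤ, (0 ≤ m ∨ k < 0) → f m k = EL 0 g m k := by
  have hpos : ∀ (n : ℕ) (k : ℤ), f n k = EL 0 (f 0) n k := by
    intro n
    induction n with
    | zero =>
      intro k
      rw [EL_apply, genBinom_zero]
      simp only [okIdx, sgnZ, Nat.cast_zero]
      rw [if_pos (by omega)]
      simp
    | succ n ih =>
      intro k
      have h1 := h n k (by omega)
      have h2 := congrFun (congrFun (ZL_EL_zero (f 0)) n) k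
      rw [ZL_apply, if_neg (by omega)] at h1 h2
      rw [ih] at h1
      simp only [Pi.zero_apply] at h2
      push_cast
      linear_combination h1 - h2
  have hneg : ∀ (n : ℕ) (k : ℤ), k < 0 → f (-(n : ℤ) - 1) k = 0 := by
    intro n
    induction n with
    | zero =>
      intro k hk
      have h1 := h (-1) (k - 1) (by omega)
      rw [ZL_apply, if_pos rfl, if_neg (by omega)] at h1
      simpa using h1
    | succ n ih =>
      intro k hk
      have h1 := h (-((n + 1 : ℕ) : ℤ) - 1) (k - 1) (by omega)
      rw [ZL_apply, if_neg (by omega), if_neg (by omega)] at h1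
      have e : -((n + 1 : ℕ) : ℤ) - 1 + 1 = -(n : ℤ) - 1 := by push_cast; ring
      rw [e, ih _ (by omega)] at h1
      simpa using h1
  refine ⟨f 0, fun m k hmk => ?_⟩
  by_cases hm : 0 ≤ m
  · obtain ⟨n, rfl⟩ := Int.eq_ofNat_of_zero_le hm
    exact hpos n k
  · obtain ⟨n, hn⟩ : ∃ n : ℕ, m = -(n : ℤ) - 1 := ⟨(-m - 1).toNat, by omega⟩
    have hk : k < 0 := by omega
    rw [hn, hneg n k hk, EL_apply, if_neg]
    simp only [okIdx]
    omega

lemma part_exists (N : ℕ) : ∀ (f : KDist2),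
    (∀ m k : ℤ, (0 ≤ m ∨ k < 0) → (ZL ^ (N + 1)) f m k = 0) →
    ∃ g : ℕ → KDist, ∀ m k : ℤ, (0 ≤ m ∨ k < 0) →
      f m k = (∑ i ∈ Finset.range (N + 1), EL i (g i)) m k := by
  induction N with
  | zero =>
    intro f hf
    obtain ⟨g, hg⟩ := base_exists f (by simpa using hf)
    exact ⟨fun _ => g, by simpa using hg⟩
  | succ N ih =>
    intro f hf
    obtain ⟨g, hg⟩ := ih (ZL f) (by
      intro m k h
      rw [← Module.End.mul_apply, ← pow_succ]
      exact hf m k h)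
    obtain ⟨g0, hg0⟩ := base_exists (f - ∑ i ∈ Finset.range (N + 1), EL (i + 1) (g i)) (by
      intro m k h
      rw [map_sub, map_sum]
      simp only [ZL_EL_succ, Pi.sub_apply]
      rw [hg m k h, sub_self])
    refine ⟨fun i => Nat.casesOn i g0 g, fun m k h => ?_⟩
    have := hg0 m k h
    rw [Finset.sum_range_succ']
    simp only [Pi.sub_apply, Pi.add_apply] at this ⊢
    change f m k = _ + EL 0 g0 m k
    rw [← this]
    ring

lemma uniq (N : ℕ) : ∀ (g : ℕ → KDist),
    (∑ i ∈ Finset.range (N + 1), EL i (g i)) = 0 → ∀ i < N + 1, g i = 0 := by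
  have base : ∀ g : KDist, EL 0 g = 0 → g = 0 := by
    intro g h
    ext s
    have h1 := congrFun (congrFun h 0) s
    rw [EL_apply, genBinom_zero, if_pos (by simp only [okIdx]; omega)] at h1
    simpa [sgnZ] using h1
  induction N with
  | zero =>
    intro g h i hi
    obtain rfl : i = 0 := by omega
    exact base _ (by simpa using h)
  | succ N ih =>
    intro g h
    rw [Finset.sum_range_succ'] at h
    have h1 := congrArg ZL h
    simp only [map_add, map_sum, ZL_EL_succ, ZL_EL_zero, add_zero, map_zero] at h1
    have h2 := ih (fun i => g (i + 1)) h1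
    have h3 : g 0 = 0 := by
      apply base
      rw [Finset.sum_eq_zero, zero_add] at h
      · exact h
      · intro i hi
        have := h2 i (by simpa using hi)
        rw [show g (i + 1) = 0 from this, map_zero]
    intro i hi
    cases i with
    | zero => exact h3
    | succ i => exact h2 i (by omega)

/-- Extend a finite family by zero and rescale by factorials. -/
def extG (N : ℕ) (g : Fin (N + 1) → KDist) : ℕ → KDist := fun i =>
  if h : i < N + 1 then (i.factorial : ℂ) • g ⟨i, h⟩ else 0

lemma sum_delta (N : ℕ) (g : Fin (N + 1) → KDist) :
    (fun m k : ℤ => ∑ i : Fin (N + 1), deltaDerivMulW i.1 (g i) m k) =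
      ∑ i ∈ Finset.range (N + 1), EL i (extG N g i) := by
  rw [Finset.sum_range]
  ext m k
  simp only [Finset.sum_apply]
  refine Finset.sum_congr rfl fun i _ => ?_
  rw [delta_eq]
  simp only [extG, dif_pos i.2]

/-- Uniqueness lemma for bivariate raviolo distributions (Lemma 1.9): a bivariate formal
raviolo distribution `f` satisfying `(z−w)^{N+1} f = 0` and, for all `m ≥ 0`,
`(Ω^m_z − Σ_{j=0}^N (−1)^j C(m+j,j) (z−w)^j Ω^{m+j}_w) f = 0` can be written uniquely as
`f = Σ_{i=0}^N ∂^i_w Δ(z−w) g⁽ⁱ⁾(w)`, and conversely every such sum satisfies the two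
conditions. -/
theorem raviolo_delta_uniqueness (N : ℕ) :
    (∀ f : KDist2,
      zmw^[N + 1] f = 0 →
      (∀ m : ℕ, ∀ m' k : ℤ,
        mulOmegaZ m f m' k
          - ∑ j ∈ Finset.range (N + 1),
              ((-1 : ℂ) ^ j * (Nat.choose (m + j) j : ℂ)) *
                (zmw^[j] (mulOmegaW (m + j) f)) m' k = 0) →
      ∃! g : Fin (N + 1) → KDist,
        ∀ m k : ℤ, f m k = ∑ i : Fin (N + 1), deltaDerivMulW i.1 (g i) m k) ∧
    (∀ g : Fin (N + 1) → KDist,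
      zmw^[N + 1] (fun m k => ∑ i : Fin (N + 1), deltaDerivMulW i.1 (g i) m k) = 0 ∧
      (∀ m : ℕ, ∀ m' k : ℤ,
        mulOmegaZ m (fun m k => ∑ i : Fin (N + 1), deltaDerivMulW i.1 (g i) m k) m' k
          - ∑ j ∈ Finset.range (N + 1),
              ((-1 : ℂ) ^ j * (Nat.choose (m + j) j : ℂ)) *
                (zmw^[j] (mulOmegaW (m + j)
                  (fun m k => ∑ i : Fin (N + 1), deltaDerivMulW i.1 (g i) m k))) m' k = 0)) := by
  constructor
  · intro f h1 h2
    rw [zmw_iter] at h1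
    obtain ⟨g, hg⟩ := part_exists N f (by intro m k _; rw [h1]; rfl)
    have hf : f = ∑ i ∈ Finset.range (N + 1), EL i (g i) := by
      set F := ∑ i ∈ Finset.range (N + 1), EL i (g i) with hF
      ext m k
      by_cases hmk : 0 ≤ m ∨ k < 0
      · exact hg m k hmk
      · have hW : ∀ j, WL j f = WL j F := by
          intro j
          ext a b
          rw [WL_apply, WL_apply]
          split_ifs with hb ha
          · rw [hg _ _ (by omega)]
          · rw [hg _ _ (by omega)]
          · rfl
        have hO : ∀ n : ℕ, OL n f = OL n F := by
          intro n
          rw [hF, conv_two, ← hF]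
          ext a b
          have := h2 n a b
          rw [sub_eq_zero] at this
          refine Eq.trans this ?_
          simp only [Finset.sum_apply, Pi.smul_apply, smul_eq_mul]
          refine Finset.sum_congr rfl fun j _ => ?_
          rw [zmw_iter, ← hW]
          rfl
        have := congrFun (congrFun (hO (-m - 1).toNat) 0) k
        rw [OL_apply, OL_apply, if_pos (by omega), if_pos (by omega)] at this
        have e : (0 : ℤ) - ((-m - 1).toNat : ℤ) - 1 = m := by omega
        rwa [e] at this
    refine ⟨fun i => ((i.1.factorial : ℂ)⁻¹) • g i.1, ?_, ?_⟩
    · have hs := sum_delta N (fun i => ((i.1.factorial : ℂ)⁻¹) • g i.1)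
      have hs2 : (∑ i ∈ Finset.range (N + 1), EL i
          (extG N (fun i => ((i.1.factorial : ℂ)⁻¹) • g i.1) i)) = f := by
        rw [hf]
        refine Finset.sum_congr rfl fun i hi => ?_
        have hi' : i < N + 1 := by simpa using hi
        have hne : (i.factorial : ℂ) ≠ 0 := by exact_mod_cast i.factorial_ne_zero
        simp only [extG, dif_pos hi']
        rw [smul_smul, mul_inv_cancel₀ hne, one_smul]
      intro m k
      rw [hs2] at hs
      exact (congrFun (congrFun hs m) k).symm
    · intro g' hg'
      have hs := sum_delta N g'
      have hs2 : f = ∑ i ∈ Finset.range (N + 1), EL i (extG N g' i) := by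
        rw [← hs]
        ext m k
        exact hg' m k
      have hz : ∑ i ∈ Finset.range (N + 1), EL i (extG N g' i - g i) = 0 := by
        simp only [map_sub, Finset.sum_sub_distrib]
        rw [← hs2, ← hf, sub_self]
      have hu := uniq N (fun i => extG N g' i - g i) hz
      funext i
      have hi := sub_eq_zero.1 (hu i.1 i.2)
      have hne : (i.1.factorial : ℂ) ≠ 0 := by exact_mod_cast i.1.factorial_ne_zero
      simp only [extG, dif_pos i.2] at hi
      rw [← hi, smul_smul, inv_mul_cancel₀ hne, one_smul]
  · intro g
    rw [sum_delta]
    refine ⟨?_, fun m m' k => ?_⟩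
    · rw [zmw_iter]
      exact conv_one (N + 1) _
    · have := congrFun (congrFun (conv_two N m (extG N g)) m') k
      rw [sub_eq_zero]
      refine Eq.trans this ?_
      simp only [Finset.sum_apply, Pi.smul_apply, smul_eq_mul]
      refine Finset.sum_congr rfl fun j _ => ?_
      rw [zmw_iter]
      rfl
end
end
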